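/- arXiv:math/0608204 — 2 statements merged into one kernel-verified Lean document; each statement's English description precedes it below -/
import Mathlib

section
/- Let T be a finite symmetric triangulation of S², ℓ a generalized Tucker labelling by {±1}, and L the simplicial extension of ℓ. Then L⁻¹({0}) is a finite disjoint union of polygonal simple closed paths, each of which passes through midpoints of edges of T whose endpoints have opposite labels. -/
/-- A finite symmetric triangulation of the unit sphere `S² ⊆ ℝ³`: a finite simplicial
complex, closed under the antipodal map, whose vertices lie on the sphere and whose
underlying space projects radially, bijectively, onto the sphere. -/
structure SymmetricSphereTriangulation where
  K : Geometry.SimplicialComplex ℝ (EuclideanSpace ℝ (Fin 3))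
  finite : K.faces.Finite
  symm : ∀ s ∈ K.faces, ∃ t ∈ K.faces,
    (t : Set (EuclideanSpace ℝ (Fin 3))) = (fun v => -v) '' (s : Set (EuclideanSpace ℝ (Fin 3)))
  vertices_on_sphere : ∀ v ∈ K.vertices, ‖v‖ = 1
  zero_not_mem : (0 : EuclideanSpace ℝ (Fin 3)) ∉ K.space
  radial_bij : Set.BijOn (fun x => ‖x‖⁻¹ • x) K.space
    (Metric.sphere (0 : EuclideanSpace ℝ (Fin 3)) 1)

/-- A generalized Tucker labelling: each vertex is labelled `+1` or `-1`, antipodal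
vertices receiving opposite labels. -/
def IsGenTuckerLabelling (T : SymmetricSphereTriangulation)
    (ℓ : EuclideanSpace ℝ (Fin 3) → ℝ) : Prop :=
  (∀ v ∈ T.K.vertices, ℓ v = 1 ∨ ℓ v = -1) ∧
  (∀ v ∈ T.K.vertices, ℓ (-v) = -ℓ v)

/-- `L` is the simplicial (piecewise affine) extension of the vertex labelling `ℓ`. -/
def IsSimplicialExtension (T : SymmetricSphereTriangulation)
    (ℓ L : EuclideanSpace ℝ (Fin 3) → ℝ) : Prop :=
  (∀ v ∈ T.K.vertices, L v = ℓ v) ∧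
  (∀ s ∈ T.K.faces, ∃ A : EuclideanSpace ℝ (Fin 3) →ᵃ[ℝ] ℝ,
    ∀ x ∈ convexHull ℝ (s : Set (EuclideanSpace ℝ (Fin 3))), L x = A x)

/-- A polygonal simple closed path: a simple closed curve which is a finite union of
line segments. -/
def IsPolygonalSimpleClosedPath (P : Set (EuclideanSpace ℝ (Fin 3))) : Prop :=
  (∃ f : Circle → EuclideanSpace ℝ (Fin 3),
    Continuous f ∧ Function.Injective f ∧ Set.range f = P) ∧
  (∃ (n : ℕ) (_ : 0 < n) (p : ZMod n → EuclideanSpace ℝ (Fin 3)),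
    P = ⋃ i, segment ℝ (p i) (p (i + 1)))

open Finsupp in
/-- A finitely supported combination with total weight zero and value zero vanishes, if it is
supported in a face of a simplicial complex. -/
theorem Geometry.SimplicialComplex.eq_zero_of_support_subset {E : Type*} [AddCommGroup E]
    [Module ℝ E] {K : Geometry.SimplicialComplex ℝ E} {s : Finset E} (hs : s ∈ K.faces)
    {f : E →₀ ℝ} (hf : f.support ⊆ s) (hsum : ∑ z ∈ s, f z = 0)
    (hlin : linearCombination ℝ id f = 0) : f = 0 := by
  have h := affineIndependent_iff.1 (K.indep hs) Finset.univ (fun i => f i)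
    (by rw [Finset.sum_coe_sort s (fun z => f z)]; exact hsum)
    (by
      rw [Finset.sum_coe_sort s (fun z => f z • z)]
      rw [linearCombination_apply, Finsupp.sum_of_support_subset _ hf _ (by simp)] at hlin
      exact hlin)
  ext z
  by_cases hz : z ∈ s
  · exact h ⟨z, hz⟩ (Finset.mem_univ _)
  · exact notMem_support_iff.1 fun hz' => hz (hf hz')

/-- Nonnegative coefficient vectors whose support is a face. -/
def Geometry.SimplicialComplex.conicCoeffs {E : Type*} [AddCommGroup E] [Module ℝ E]
    (K : Geometry.SimplicialComplex ℝ E) : Set (E →₀ ℝ) :=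
  {c | (∀ z, 0 ≤ c z) ∧ c.support ∈ K.faces}

namespace Geometry.SimplicialComplex

open Finsupp

variable {E : Type*} [AddCommGroup E] [Module ℝ E] {K : Geometry.SimplicialComplex ℝ E}

theorem smul_mem_conicCoeffs {c : E →₀ ℝ} (hc : c ∈ K.conicCoeffs) {r : ℝ} (hr : 0 < r) :
    r • c ∈ K.conicCoeffs := by
  refine ⟨fun z => mul_nonneg hr.le (hc.1 z), ?_⟩
  rw [support_smul_eq hr.ne']
  exact hc.2

theorem weight_pos {c : E →₀ ℝ} (hc : c ∈ K.conicCoeffs) : 0 < ∑ z ∈ c.support, c z :=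
  Finset.sum_pos (fun z hz => (hc.1 z).lt_of_ne' (mem_support_iff.1 hz))
    (K.nonempty_of_mem_faces hc.2)

theorem linearCombination_mem_convexHull {c : E →₀ ℝ} (hc : c ∈ K.conicCoeffs)
    (h1 : ∑ z ∈ c.support, c z = 1) :
    linearCombination ℝ id c ∈ convexHull ℝ (c.support : Set E) :=
  Finset.mem_convexHull'.2 ⟨c, fun z _ => hc.1 z, h1, rfl⟩

/-- Barycentric coordinates in a simplicial complex are unique. -/
theorem conicCoeffs_eq_of_weight_one {c d : E →₀ ℝ} (hc : c ∈ K.conicCoeffs)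
    (hd : d ∈ K.conicCoeffs) (hc1 : ∑ z ∈ c.support, c z = 1) (hd1 : ∑ z ∈ d.support, d z = 1)
    (h : linearCombination ℝ id c = linearCombination ℝ id d) : c = d := by
  classical
  have hmem := K.inter_subset_convexHull hc.2 hd.2
    ⟨linearCombination_mem_convexHull hc hc1, h ▸ linearCombination_mem_convexHull hd hd1⟩
  rw [← Finset.coe_inter, Finset.mem_convexHull'] at hmem
  obtain ⟨w, -, hw1, hwx⟩ := hmem
  set e : E →₀ ℝ := indicator (c.support ∩ d.support) fun z _ => w z with he
  have hesupp : e.support ⊆ c.support ∩ d.support := support_indicator_subset _ _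
  have hew : ∀ z ∈ c.support ∩ d.support, e z = w z := fun z hz => by
    rw [he, indicator_of_mem hz]
  have hesum : ∀ s, c.support ∩ d.support ⊆ s → ∑ z ∈ s, e z = 1 := fun s hs => by
    rw [← hw1, ← Finset.sum_congr rfl hew]
    exact (Finset.sum_subset hs fun z _ hz => notMem_support_iff.1 fun h => hz (hesupp h)).symm
  have helin : linearCombination ℝ id e = linearCombination ℝ id c := by
    rw [← hwx, linearCombination_apply, Finsupp.sum_of_support_subset _ hesupp _ (by simp)]
    exact Finset.sum_congr rfl fun z hz => by rw [hew z hz, id]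
  have key : ∀ b : E →₀ ℝ, b.support ∈ K.faces → ∑ z ∈ b.support, b z = 1 →
      c.support ∩ d.support ⊆ b.support →
      linearCombination ℝ id b = linearCombination ℝ id c → b = e := by
    intro b hb hb1 hsub hlin
    refine sub_eq_zero.1 (K.eq_zero_of_support_subset hb ?_ ?_ ?_)
    · exact support_sub.trans (Finset.union_subset subset_rfl (hesupp.trans hsub))
    · simp [Finset.sum_sub_distrib, hb1, hesum _ hsub]
    · rw [map_sub, hlin, helin, sub_self]
  exact (key c hc.2 hc1 Finset.inter_subset_left rfl).trans
    (key d hd.2 hd1 Finset.inter_subset_right h.symm).symm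

/-- Every point of the underlying space has barycentric coordinates. -/
theorem exists_conicCoeffs_of_mem_convexHull {s : Finset E} (hs : s ∈ K.faces) {x : E}
    (hx : x ∈ convexHull ℝ (s : Set E)) :
    ∃ c ∈ K.conicCoeffs, c.support ⊆ s ∧ ∑ z ∈ c.support, c z = 1 ∧
      linearCombination ℝ id c = x := by
  classical
  obtain ⟨w, hw0, hw1, hwx⟩ := Finset.mem_convexHull'.1 hx
  set c : E →₀ ℝ := indicator s fun z _ => w z with hc
  have hcs : c.support ⊆ s := support_indicator_subset _ _
  have hcw : ∀ z ∈ s, c z = w z := fun z hz => by rw [hc, indicator_of_mem hz]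
  have hc1 : ∑ z ∈ c.support, c z = 1 := by
    rw [← hw1, ← Finset.sum_congr rfl hcw]
    exact Finset.sum_subset hcs fun z _ hz => notMem_support_iff.1 hz
  refine ⟨c, ⟨fun z => ?_, K.down_closed hs hcs ?_⟩, hcs, hc1, ?_⟩
  · by_cases hz : z ∈ s
    · rw [hcw z hz]
      exact hw0 z hz
    · rw [notMem_support_iff.1 fun h => hz (hcs h)]
  · refine Finset.nonempty_iff_ne_empty.2 fun h => ?_
    simp [h] at hc1
  · rw [← hwx, linearCombination_apply, Finsupp.sum_of_support_subset _ hcs _ (by simp)]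
    exact Finset.sum_congr rfl fun z hz => by rw [hcw z hz, id]

end Geometry.SimplicialComplex

namespace SymmetricSphereTriangulation

open Finsupp

variable (T : SymmetricSphereTriangulation)

/-- The cones over the faces of a triangulation of the sphere have disjoint relative interiors,
and positive coefficients in them are unique. -/
theorem conicCoeffs_injOn :
    Set.InjOn (linearCombination ℝ (id : EuclideanSpace ℝ (Fin 3) → _)) T.K.conicCoeffs := by
  intro c hc d hd h
  have hC := T.K.weight_pos hc
  have hD := T.K.weight_pos hd
  set C := ∑ z ∈ c.support, c z with hCdef
  set D := ∑ z ∈ d.support, d z with hDdef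
  have hc' := T.K.smul_mem_conicCoeffs hc (inv_pos.2 hC)
  have hd' := T.K.smul_mem_conicCoeffs hd (inv_pos.2 hD)
  have hc1 : ∑ z ∈ (C⁻¹ • c).support, (C⁻¹ • c) z = 1 := by
    rw [support_smul_eq (inv_pos.2 hC).ne']
    simp [← Finset.mul_sum, ← hCdef, hC.ne']
  have hd1 : ∑ z ∈ (D⁻¹ • d).support, (D⁻¹ • d) z = 1 := by
    rw [support_smul_eq (inv_pos.2 hD).ne']
    simp [← Finset.mul_sum, ← hDdef, hD.ne']
  have hcx := T.K.convexHull_subset_space hc'.2 (T.K.linearCombination_mem_convexHull hc' hc1)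
  have hdx := T.K.convexHull_subset_space hd'.2 (T.K.linearCombination_mem_convexHull hd' hd1)
  have hray : ∀ (r : ℝ) (x : EuclideanSpace ℝ (Fin 3)), 0 < r →
      ‖r • x‖⁻¹ • (r • x) = ‖x‖⁻¹ • x := fun r x hr => by
    rw [norm_smul, Real.norm_of_nonneg hr.le, smul_smul, mul_inv, mul_right_comm,
      inv_mul_cancel₀ hr.ne', one_mul]
  have heq := T.radial_bij.injOn hcx hdx (by
    simp only [map_smul, h]
    rw [hray _ _ (inv_pos.2 hC), hray _ _ (inv_pos.2 hD)])
  have hscaled := T.K.conicCoeffs_eq_of_weight_one hc' hd' hc1 hd1 heq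
  have hne : linearCombination ℝ id d ≠ 0 := fun h0 => T.zero_not_mem (by
    rw [map_smul, h0, smul_zero] at hdx
    exact hdx)
  have hCD : C = D := by
    rw [map_smul, map_smul, h] at heq
    exact inv_injective (smul_left_injective ℝ hne heq)
  rw [hCD] at hscaled
  exact (smul_right_injective _ (inv_pos.2 hD).ne') hscaled

/-- The cones over the faces of a triangulation of the sphere cover the punctured space. -/
theorem exists_conicCoeffs {x : EuclideanSpace ℝ (Fin 3)} (hx : x ≠ 0) :
    ∃ c ∈ T.K.conicCoeffs, linearCombination ℝ id c = x := by
  have hx' : 0 < ‖x‖ := norm_pos_iff.2 hx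
  obtain ⟨y, hy, hyx⟩ := T.radial_bij.surjOn (a := ‖x‖⁻¹ • x) (by simp [norm_smul, hx'.ne'])
  have hy' : 0 < ‖y‖ := norm_pos_iff.2 fun h => T.zero_not_mem (h ▸ hy)
  obtain ⟨s, hs, hys⟩ := T.K.mem_space_iff.1 hy
  obtain ⟨c, hc, -, -, hcy⟩ := T.K.exists_conicCoeffs_of_mem_convexHull hs hys
  refine ⟨(‖x‖ * ‖y‖⁻¹) • c, T.K.smul_mem_conicCoeffs hc (by positivity), ?_⟩
  dsimp only at hyx
  rw [map_smul, hcy, mul_smul, hyx, smul_smul, mul_inv_cancel₀ hx'.ne', one_smul]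

/-- The vertices of a face are linearly independent. -/
theorem linearIndepOn {s : Finset (EuclideanSpace ℝ (Fin 3))} (hs : s ∈ T.K.faces) :
    LinearIndepOn ℝ id (s : Set (EuclideanSpace ℝ (Fin 3))) := by
  classical
  rw [linearIndepOn_iff]
  intro l hl h0
  have hls : l.support ⊆ s := by exact_mod_cast (mem_supported ℝ l).1 hl
  set u : EuclideanSpace ℝ (Fin 3) →₀ ℝ := indicator s fun _ _ => 1
  obtain ⟨N, hN⟩ : ∃ N : ℝ, ∀ z ∈ s, |l z| < N := by
    obtain ⟨N, hN⟩ := (s.image fun z => |l z|).bddAbove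
    exact ⟨N + 1, fun z hz => (hN (by simpa using ⟨z, hz, rfl⟩)).trans_lt (lt_add_one N)⟩
  have hN0 : 0 < N := by
    obtain ⟨z, hz⟩ := T.K.nonempty_of_mem_faces hs
    exact (abs_nonneg _).trans_lt (hN z hz)
  have hu : ∀ z, u z = if z ∈ s then 1 else 0 := fun z => by simp [u, indicator_apply]
  have hl0 : ∀ z ∉ s, l z = 0 := fun z hz => notMem_support_iff.1 fun h => hz (hls h)
  have hmem : ∀ b : EuclideanSpace ℝ (Fin 3) →₀ ℝ, (∀ z ∈ s, 0 < b z) → (∀ z ∉ s, b z = 0) →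
      b ∈ T.K.conicCoeffs := by
    intro b hb hb'
    have : b.support = s := by
      ext z
      by_cases hz : z ∈ s
      · simp [hz, (hb z hz).ne']
      · simp [hz, hb' z hz]
    refine ⟨fun z => ?_, this ▸ hs⟩
    by_cases hz : z ∈ s
    · exact (hb z hz).le
    · exact (hb' z hz).ge
  have := T.conicCoeffs_injOn (hmem (N • u + l) ?_ ?_) (hmem (N • u) ?_ ?_)
    (by rw [map_add, h0, add_zero])
  · simpa using this
  · intro z hz
    have := neg_lt_of_abs_lt (hN z hz)
    simp [hu, hz]
    linarith
  · intro z hz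
    simp [hu, hz, hl0]
  · intro z hz
    simp [hu, hz, hN0]
  · intro z hz
    simp [hu, hz]

theorem card_le_three {s : Finset (EuclideanSpace ℝ (Fin 3))} (hs : s ∈ T.K.faces) :
    s.card ≤ 3 := by
  have := LinearIndependent.fintype_card_le_finrank (T.linearIndepOn hs)
  simpa using this

end SymmetricSphereTriangulation

/-- The oriented volume of three vectors in space. -/
def tripleProduct (a b c : EuclideanSpace ℝ (Fin 3)) : ℝ :=
  a 0 * (b 1 * c 2 - b 2 * c 1) - a 1 * (b 0 * c 2 - b 2 * c 0) + a 2 * (b 0 * c 1 - b 1 * c 0)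

section tripleProduct

theorem tripleProduct_swap_left (a b c : EuclideanSpace ℝ (Fin 3)) :
    tripleProduct b a c = -tripleProduct a b c := by
  unfold tripleProduct
  ring

theorem tripleProduct_swap_right (a b c : EuclideanSpace ℝ (Fin 3)) :
    tripleProduct a c b = -tripleProduct a b c := by
  unfold tripleProduct
  ring

theorem tripleProduct_self_left (a b : EuclideanSpace ℝ (Fin 3)) : tripleProduct a b a = 0 := by
  unfold tripleProduct
  ring

theorem tripleProduct_self_right (a b : EuclideanSpace ℝ (Fin 3)) : tripleProduct a b b = 0 := by
  unfold tripleProduct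
  ring

theorem tripleProduct_add_smul (a b c : EuclideanSpace ℝ (Fin 3)) (r : ℝ) :
    tripleProduct a b (a + b + r • c) = r * tripleProduct a b c := by
  simp only [tripleProduct, PiLp.add_apply, PiLp.smul_apply, smul_eq_mul]
  ring

theorem tripleProduct_linearCombination (a b : EuclideanSpace ℝ (Fin 3))
    (c : EuclideanSpace ℝ (Fin 3) →₀ ℝ) :
    tripleProduct a b (Finsupp.linearCombination ℝ id c) =
      ∑ z ∈ c.support, c z * tripleProduct a b z := by
  simp only [tripleProduct, Finsupp.linearCombination_apply, Finsupp.sum, id, mul_add, mul_sub,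
    WithLp.ofLp_sum, Finset.sum_apply, PiLp.smul_apply, smul_eq_mul, Finset.sum_add_distrib,
    Finset.sum_sub_distrib, Finset.mul_sum]
  simp only [mul_left_comm]

/-- Cramer's rule. -/
theorem tripleProduct_cramer (a b c x : EuclideanSpace ℝ (Fin 3)) :
    tripleProduct a b c • x =
      tripleProduct x b c • a + tripleProduct a x c • b + tripleProduct a b x • c := by
  ext i
  fin_cases i <;> simp [tripleProduct] <;> ring

theorem exists_tripleProduct_pos {a b : EuclideanSpace ℝ (Fin 3)} (ha : a ≠ 0)
    (hab : ∀ r s : ℝ, r • a + s • b = 0 → s = 0) : ∃ c, 0 < tripleProduct a b c := by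
  set c : EuclideanSpace ℝ (Fin 3) :=
    !₂[a 1 * b 2 - a 2 * b 1, a 2 * b 0 - a 0 * b 2, a 0 * b 1 - a 1 * b 0] with hc
  have hval : tripleProduct a b c = (a 1 * b 2 - a 2 * b 1) ^ 2 + (a 2 * b 0 - a 0 * b 2) ^ 2 +
      (a 0 * b 1 - a 1 * b 0) ^ 2 := by
    simp [tripleProduct, hc]
    ring
  refine ⟨c, lt_of_le_of_ne (hval ▸ by positivity) fun h0 => ha ?_⟩
  rw [hval] at h0
  have h1 : a 1 * b 2 - a 2 * b 1 = 0 := by nlinarith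
  have h2 : a 2 * b 0 - a 0 * b 2 = 0 := by nlinarith
  have h3 : a 0 * b 1 - a 1 * b 0 = 0 := by nlinarith
  ext i
  refine hab (-b i) (a i) ?_
  ext j
  fin_cases i <;> fin_cases j <;> simp <;> linarith

end tripleProduct

/-- The finitely supported vector with three prescribed coefficients. -/
noncomputable def tripleCoeff {E : Type*} (v w u : E) (a b c : ℝ) : E →₀ ℝ :=
  Finsupp.single v a + Finsupp.single w b + Finsupp.single u c

theorem linearCombination_tripleCoeff {E : Type*} [AddCommGroup E] [Module ℝ E] (v w u : E)
    (a b c : ℝ) :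
    Finsupp.linearCombination ℝ id (tripleCoeff v w u a b c) = a • v + b • w + c • u := by
  simp [tripleCoeff]

theorem support_tripleCoeff {E : Type*} [DecidableEq E] (v w u : E) {a b c : ℝ} (ha : 0 < a)
    (hb : 0 < b) (hc : 0 < c) : (tripleCoeff v w u a b c).support = {v, w, u} := by
  ext z
  simp only [tripleCoeff, Finsupp.mem_support_iff, Finsupp.add_apply, Finsupp.single_apply,
    Finset.mem_insert, Finset.mem_singleton]
  constructor
  · contrapose!
    rintro ⟨h1, h2, h3⟩
    simp [h1.symm, h2.symm, h3.symm]
  · intro h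
    apply ne_of_gt
    split_ifs <;> first | positivity | (exfalso; tauto)

theorem Geometry.SimplicialComplex.tripleCoeff_mem_conicCoeffs {E : Type*} [DecidableEq E]
    [AddCommGroup E] [Module ℝ E] {K : Geometry.SimplicialComplex ℝ E} {v w u : E}
    (h : ({v, w, u} : Finset E) ∈ K.faces) {a b c : ℝ} (ha : 0 < a) (hb : 0 < b) (hc : 0 < c) :
    tripleCoeff v w u a b c ∈ K.conicCoeffs := by
  refine ⟨fun z => ?_, by rwa [support_tripleCoeff v w u ha hb hc]⟩
  simp only [tripleCoeff, Finsupp.add_apply, Finsupp.single_apply]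
  split_ifs <;> positivity

namespace SymmetricSphereTriangulation

open Finsupp

variable (T : SymmetricSphereTriangulation)

/-- The closed cone over a face is closed. -/
theorem isClosed_cone {s : Finset (EuclideanSpace ℝ (Fin 3))} (hs : s ∈ T.K.faces) :
    IsClosed (linearCombination ℝ (id : EuclideanSpace ℝ (Fin 3) → _) ''
      {c | (∀ z, 0 ≤ c z) ∧ c.support ⊆ s}) := by
  set φ : (s → ℝ) →ₗ[ℝ] EuclideanSpace ℝ (Fin 3) :=
    Fintype.linearCombination ℝ fun z : s => (z : EuclideanSpace ℝ (Fin 3)) with hφdef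
  have hφ : LinearMap.ker φ = ⊥ :=
    LinearMap.ker_eq_bot.2
      (LinearIndependent.fintypeLinearCombination_injective (T.linearIndepOn hs))
  convert (LinearMap.isClosedEmbedding_of_injective hφ).isClosedMap _
    (isClosed_Ici (a := (0 : s → ℝ))) using 1
  ext x
  constructor
  · rintro ⟨c, ⟨hc, hcs⟩, rfl⟩
    refine ⟨fun z => c z, fun z => hc z, ?_⟩
    rw [hφdef, Fintype.linearCombination_apply, linearCombination_apply,
      Finsupp.sum_of_support_subset _ hcs _ (by simp)]
    exact Finset.sum_coe_sort s fun z => c z • z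
  · rintro ⟨f, hf, rfl⟩
    refine ⟨indicator s fun z hz => f ⟨z, hz⟩, ⟨fun z => ?_, support_indicator_subset _ _⟩, ?_⟩
    · rw [indicator_apply]
      split_ifs
      · exact hf _
      · exact le_rfl
    · rw [hφdef, Fintype.linearCombination_apply, linearCombination_apply,
        Finsupp.sum_of_support_subset _ (support_indicator_subset _ _) _ (by simp),
        ← Finset.sum_coe_sort]
      exact Finset.sum_congr rfl fun z _ => by rw [indicator_of_mem z.2, id]

variable {T}

/-- Near a positive combination of the vertices of an edge only cones over faces containing that
edge occur. -/
theorem exists_face_of_direction {v w : EuclideanSpace ℝ (Fin 3)} (h : {v, w} ∈ T.K.faces)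
    (n : EuclideanSpace ℝ (Fin 3)) :
    ∃ c ∈ T.K.conicCoeffs, {v, w} ⊆ c.support ∧
      ∃ r : ℝ, 0 < r ∧ linearCombination ℝ id c = v + w + r • n := by
  have hvw : tripleCoeff v w w 1 (1 / 2) (1 / 2) ∈ T.K.conicCoeffs :=
    T.K.tripleCoeff_mem_conicCoeffs (by rwa [Finset.pair_eq_singleton]) one_pos one_half_pos
      one_half_pos
  have hvwlin : linearCombination ℝ id (tripleCoeff v w w 1 (1 / 2) (1 / 2)) = v + w := by
    rw [linearCombination_tripleCoeff, one_smul, add_assoc, ← add_smul, add_halves, one_smul]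
  have hvw0 : v + w ≠ 0 := by
    intro h0
    rw [← hvwlin] at h0
    have := linearIndepOn_iff.1 (T.linearIndepOn hvw.2) _ ((mem_supported ℝ _).2 subset_rfl) h0
    have hne := T.K.nonempty_of_mem_faces hvw.2
    rw [this] at hne
    simp at hne
  have htend : Filter.Tendsto (fun r : ℝ => v + w + r • n) (nhdsWithin 0 (Set.Ioi 0))
      (nhds (v + w)) := by
    have : Continuous fun r : ℝ => v + w + r • n := by fun_prop
    simpa using (this.tendsto 0).mono_left nhdsWithin_le_nhds
  have hev : ∀ᶠ r : ℝ in nhdsWithin 0 (Set.Ioi 0), ∃ s ∈ T.K.faces,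
      ∃ c ∈ T.K.conicCoeffs, c.support = s ∧ linearCombination ℝ id c = v + w + r • n := by
    filter_upwards [htend.eventually_ne hvw0] with r hr
    obtain ⟨c, hc, hcx⟩ := T.exists_conicCoeffs hr
    exact ⟨_, hc.2, c, hc, rfl, hcx⟩
  obtain ⟨s, hs, hfreq⟩ : ∃ s ∈ T.K.faces, ∃ᶠ r : ℝ in nhdsWithin 0 (Set.Ioi 0),
      ∃ c ∈ T.K.conicCoeffs, c.support = s ∧ linearCombination ℝ id c = v + w + r • n := by
    by_contra hcon
    obtain ⟨r, ⟨s, hs, hr⟩, hr'⟩ := (hev.and ((Filter.eventually_all_finite T.finite).2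
      fun s hs => Filter.not_frequently.1 fun hfr => hcon ⟨s, hs, hfr⟩)).exists
    exact hr' s hs hr
  obtain ⟨d, ⟨hd0, hds⟩, hdlin⟩ := (T.isClosed_cone hs).mem_of_frequently_of_tendsto
    (hfreq.mono fun r ⟨c, hc, hcs, hcx⟩ => ⟨c, ⟨hc.1, hcs.subset⟩, hcx⟩) htend
  have hd : d ∈ T.K.conicCoeffs := by
    refine ⟨hd0, T.K.down_closed hs hds (Finset.nonempty_iff_ne_empty.2 fun h0 => hvw0 ?_)⟩
    rw [← hdlin, support_eq_empty.1 h0, map_zero]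
  obtain rfl := T.conicCoeffs_injOn hd hvw (hdlin.trans hvwlin.symm)
  obtain ⟨r, ⟨c, hc, rfl, hcx⟩, hr⟩ := (hfreq.and_eventually self_mem_nhdsWithin).exists
  refine ⟨c, hc, ?_, r, hr, hcx⟩
  rw [support_tripleCoeff v w w one_pos one_half_pos one_half_pos] at hds
  intro z hz
  exact hds (by simpa using hz)

/-- There is a triangle on the positive side of each edge. -/
theorem exists_triangle
    {v w : EuclideanSpace ℝ (Fin 3)} (h : {v, w} ∈ T.K.faces)
    (hne : v ≠ w) : ∃ u, {v, w, u} ∈ T.K.faces ∧ 0 < tripleProduct v w u := by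
  have hLI : ∀ r s : ℝ, r • v + s • w = 0 → r = 0 ∧ s = 0 := by
    have := (T.linearIndepOn h)
    rw [Finset.coe_pair, LinearIndepOn.pair_iff _ hne] at this
    exact this
  obtain ⟨n, hn⟩ := exists_tripleProduct_pos (a := v) (b := w)
    (fun h0 => one_ne_zero (hLI 1 0 (by simp [h0])).1) (fun r s hrs => (hLI r s hrs).2)
  obtain ⟨c, hc, hsub, r, hr, hcx⟩ := exists_face_of_direction h n
  have hpos : 0 < tripleProduct v w (linearCombination ℝ id c) := by
    rw [hcx, tripleProduct_add_smul]
    positivity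
  rw [tripleProduct_linearCombination] at hpos
  obtain ⟨u, hu, hupos⟩ := Finset.exists_lt_of_sum_lt
    (f := fun _ : EuclideanSpace ℝ (Fin 3) => (0 : ℝ)) (by simpa using hpos)
  refine ⟨u, T.K.down_closed hc.2 ?_ (by simp), pos_of_mul_pos_right hupos (hc.1 u)⟩
  simp only [Finset.insert_subset_iff, Finset.singleton_subset_iff] at hsub ⊢
  exact ⟨hsub.1, hsub.2, hu⟩

/-- There is at most one triangle on the positive side of each edge. -/
theorem triangle_unique
    {v w u u' : EuclideanSpace ℝ (Fin 3)} (h : {v, w, u} ∈ T.K.faces)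
    (h' : {v, w, u'} ∈ T.K.faces) (hu : 0 < tripleProduct v w u)
    (hu' : 0 < tripleProduct v w u') : u = u' := by
  set N : ℝ := |tripleProduct u' w u| + |tripleProduct v u' u| + 1
  have hN : 0 < N := by positivity
  have hNa : 0 < N + tripleProduct u' w u := by
    have := neg_abs_le (tripleProduct u' w u)
    have := abs_nonneg (tripleProduct v u' u)
    simp only [N]
    linarith
  have hNb : 0 < N + tripleProduct v u' u := by
    have := neg_abs_le (tripleProduct v u' u)
    have := abs_nonneg (tripleProduct u' w u)
    simp only [N]
    linarith
  have heq := T.conicCoeffs_injOn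
    (T.K.tripleCoeff_mem_conicCoeffs h' hN hN hu)
    (T.K.tripleCoeff_mem_conicCoeffs h hNa hNb hu') (by
      rw [linearCombination_tripleCoeff, linearCombination_tripleCoeff, tripleProduct_cramer]
      module)
  have hsupp := congrArg support heq
  rw [support_tripleCoeff _ _ _ hN hN hu, support_tripleCoeff _ _ _ hNa hNb hu'] at hsupp
  have hmem : u ∈ ({v, w, u'} : Finset _) := hsupp ▸ by simp
  simp only [Finset.mem_insert, Finset.mem_singleton] at hmem
  rcases hmem with rfl | rfl | rfl
  · simp [tripleProduct_self_left] at hu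
  · simp [tripleProduct_self_right] at hu
  · rfl

theorem tripleProduct_ne_zero
    {a b c : EuclideanSpace ℝ (Fin 3)} (h : {a, b, c} ∈ T.K.faces) (hab : a ≠ b) (hac : a ≠ c)
    (hbc : b ≠ c) : tripleProduct a b c ≠ 0 := by
  have hLI : ∀ r s t : ℝ, r • a + s • b + t • c = 0 → tripleCoeff a b c r s t = 0 := by
    intro r s t h0
    refine linearIndepOn_iff.1 (T.linearIndepOn h) _ ((mem_supported ℝ _).2 ?_) ?_
    · intro z hz
      simp only [Finset.coe_insert, Finset.coe_singleton, Set.mem_insert_iff,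
        Set.mem_singleton_iff]
      by_contra! hcon
      simp [tripleCoeff, hcon.1.symm, hcon.2.1.symm, hcon.2.2.symm] at hz
    · rw [linearCombination_tripleCoeff, h0]
  intro h0
  obtain ⟨x, hx⟩ := exists_tripleProduct_pos (a := a) (b := b)
    (fun ha => by
      have := DFunLike.congr_fun (hLI 1 0 0 (by simp [ha])) a
      simp [tripleCoeff] at this)
    (fun r s hrs => by
      have := DFunLike.congr_fun (hLI r s 0 (by simpa using hrs)) b
      simpa [tripleCoeff, hab] using this)
  have := DFunLike.congr_fun (hLI _ _ _ ((tripleProduct_cramer a b c x).symm.trans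
    (by rw [h0, zero_smul]))) c
  simp [tripleCoeff, hac, hbc] at this
  exact hx.ne' this

/-- An edge with oppositely labelled endpoints, directed from the positive endpoint to the negative
one. -/
abbrev Crossing (T : SymmetricSphereTriangulation) (ℓ : EuclideanSpace ℝ (Fin 3) → ℝ) : Type :=
  {p : EuclideanSpace ℝ (Fin 3) × EuclideanSpace ℝ (Fin 3) //
    {p.1, p.2} ∈ T.K.faces ∧ ℓ p.1 = 1 ∧ ℓ p.2 = -1}

instance (T : SymmetricSphereTriangulation) (ℓ : EuclideanSpace ℝ (Fin 3) → ℝ) :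
    Finite (Crossing T ℓ) := by
  have hfin : (⋃ s ∈ T.K.faces, (s : Set (EuclideanSpace ℝ (Fin 3)))).Finite :=
    T.finite.biUnion fun s _ => s.finite_toSet
  refine Set.Finite.to_subtype ((hfin.prod hfin).subset ?_)
  rintro p ⟨hp, -⟩
  exact ⟨Set.mem_biUnion hp (by simp), Set.mem_biUnion hp (by simp)⟩

variable {ℓ L : EuclideanSpace ℝ (Fin 3) → ℝ}

/-- The midpoint of a crossing edge. -/
noncomputable def Crossing.mid (e : Crossing T ℓ) : EuclideanSpace ℝ (Fin 3) :=
  midpoint ℝ e.1.1 e.1.2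

/-- `f` is the other crossing edge of the triangle on the positive side of `e`. -/
def Crossing.IsNext (e f : Crossing T ℓ) : Prop :=
  ∃ u, {e.1.1, e.1.2, u} ∈ T.K.faces ∧ 0 < tripleProduct e.1.1 e.1.2 u ∧
    (ℓ u = 1 ∧ f.1 = (u, e.1.2) ∨ ℓ u = -1 ∧ f.1 = (e.1.1, u))

theorem mem_vertices {s : Finset (EuclideanSpace ℝ (Fin 3))} (hs : s ∈ T.K.faces)
    {z : EuclideanSpace ℝ (Fin 3)} (hz : z ∈ s) : z ∈ T.K.vertices :=
  T.K.down_closed hs (Finset.singleton_subset_iff.2 hz) (Finset.singleton_nonempty z)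

theorem Crossing.exists_isNext (hℓ : IsGenTuckerLabelling T ℓ) (e : Crossing T ℓ) :
    ∃ f, e.IsNext f := by
  obtain ⟨⟨v, w⟩, he, hv, hw⟩ := e
  obtain ⟨u, hu, hpos⟩ := exists_triangle he (by
    dsimp only at *
    rintro rfl
    norm_num [hv] at hw)
  rcases hℓ.1 u (mem_vertices hu (by simp)) with h | h
  · have hf : {u, w} ∈ T.K.faces := T.K.down_closed hu (by grind) (by simp)
    exact ⟨⟨(u, w), hf, h, hw⟩, u, hu, hpos, Or.inl ⟨h, rfl⟩⟩
  · have hf : {v, u} ∈ T.K.faces := T.K.down_closed hu (by grind) (by simp)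
    exact ⟨⟨(v, u), hf, hv, h⟩, u, hu, hpos, Or.inr ⟨h, rfl⟩⟩

theorem tripleProduct_rotate (a b c : EuclideanSpace ℝ (Fin 3)) :
    tripleProduct b c a = tripleProduct a b c := by
  rw [tripleProduct_swap_right, tripleProduct_swap_left, neg_neg]

theorem rotate_mem_faces
    {a b c : EuclideanSpace ℝ (Fin 3)} (h : {a, b, c} ∈ T.K.faces) : {b, c, a} ∈ T.K.faces := by
  convert h using 1
  grind

theorem Crossing.IsNext.left_unique {e e' f : Crossing T ℓ} (h : e.IsNext f) (h' : e'.IsNext f) :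
    e = e' := by
  obtain ⟨⟨v, w⟩, he, hv, hw⟩ := e
  obtain ⟨⟨v', w'⟩, he', hv', hw'⟩ := e'
  obtain ⟨u, hu, hpos, hf⟩ := h
  obtain ⟨u', hu', hpos', hf'⟩ := h'
  dsimp only at *
  refine Subtype.ext ?_
  have h1 := rotate_mem_faces hu
  have h2 := rotate_mem_faces h1
  have h1' := rotate_mem_faces hu'
  have h2' := rotate_mem_faces h1'
  have p1 := (tripleProduct_rotate v w u).trans_gt hpos
  have p2 := (tripleProduct_rotate w u v).trans_gt p1
  have p1' := (tripleProduct_rotate v' w' u').trans_gt hpos'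
  have p2' := (tripleProduct_rotate w' u' v').trans_gt p1'
  rcases hf with ⟨hℓu, hf⟩ | ⟨hℓu, hf⟩ <;> rcases hf' with ⟨hℓu', hf'⟩ | ⟨hℓu', hf'⟩ <;>
    rw [hf, Prod.mk.injEq] at hf' <;> obtain ⟨rfl, rfl⟩ := hf'
  · exact Prod.ext (triangle_unique h1 h1' p1 p1') rfl
  · rw [triangle_unique h1 h2' p1 p2'] at hv
    norm_num [hw'] at hv
  · rw [triangle_unique h2 h1' p2 p1'] at hw
    norm_num [hv'] at hw
  · exact Prod.ext rfl (triangle_unique h2 h2' p2 p2')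

theorem Crossing.IsNext.right_unique {e f f' : Crossing T ℓ} (h : e.IsNext f) (h' : e.IsNext f') :
    f = f' := by
  obtain ⟨u, hu, hpos, hf⟩ := h
  obtain ⟨u', hu', hpos', hf'⟩ := h'
  obtain rfl := triangle_unique hu hu' hpos hpos'
  refine Subtype.ext ?_
  rcases hf with ⟨hℓu, hf⟩ | ⟨hℓu, hf⟩ <;> rcases hf' with ⟨hℓu', hf'⟩ | ⟨hℓu', hf'⟩ <;>
    first | exact hf.trans hf'.symm | linarith

theorem Crossing.mid_eq (e : Crossing T ℓ) :
    e.mid = (1 / 2 : ℝ) • e.1.1 + (1 / 2 : ℝ) • e.1.2 := by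
  rw [Crossing.mid, midpoint_eq_smul_add, smul_add, invOf_eq_inv, one_div]

/-- Conic coordinates of the points on the segment between consecutive midpoints. -/
theorem Crossing.IsNext.exists_conicCoeffs
    {e f : Crossing T ℓ} (h : e.IsNext f) {s : ℝ} (hs : s ∈ Set.Ico (0 : ℝ) 1) :
    ∃ c ∈ T.K.conicCoeffs, linearCombination ℝ id c = AffineMap.lineMap e.mid f.mid s ∧
      (s = 0 ∧ c.support = {e.1.1, e.1.2} ∨ 0 < s ∧ ∃ u, (ℓ u = 1 ∨ ℓ u = -1) ∧
        0 < tripleProduct e.1.1 e.1.2 u ∧ c.support = {e.1.1, e.1.2, u} ∧ c u = s / 2) := by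
  obtain ⟨⟨v, w⟩, he, hv, hw⟩ := e
  obtain ⟨u, hu, hpos, hf⟩ := h
  dsimp only at *
  rcases hs.1.eq_or_lt with rfl | hs0
  · refine ⟨tripleCoeff v w w (1 / 2) (1 / 4) (1 / 4), T.K.tripleCoeff_mem_conicCoeffs
      (by rwa [Finset.pair_eq_singleton]) (by norm_num) (by norm_num) (by norm_num), ?_,
      Or.inl ⟨rfl, ?_⟩⟩
    · rw [linearCombination_tripleCoeff, AffineMap.lineMap_apply_zero, Crossing.mid_eq]
      module
    · rw [support_tripleCoeff _ _ _ (by norm_num) (by norm_num) (by norm_num),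
        Finset.pair_eq_singleton]
  · have huv : v ≠ u := by
      rintro rfl
      exact hpos.ne' (tripleProduct_self_left _ _)
    have huw : w ≠ u := by
      rintro rfl
      exact hpos.ne' (tripleProduct_self_right _ _)
    have hs1 : 0 < (1 - s) / 2 := by linarith [hs.2]
    have hs2 : 0 < s / 2 := by linarith
    rcases hf with ⟨hℓu, hf⟩ | ⟨hℓu, hf⟩
    · refine ⟨tripleCoeff v w u ((1 - s) / 2) (1 / 2) (s / 2),
        T.K.tripleCoeff_mem_conicCoeffs hu hs1 one_half_pos hs2, ?_,
        Or.inr ⟨hs0, u, Or.inl hℓu, hpos, support_tripleCoeff _ _ _ hs1 one_half_pos hs2, ?_⟩⟩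
      · rw [linearCombination_tripleCoeff, Crossing.mid_eq, Crossing.mid_eq, hf,
          AffineMap.lineMap_apply_module]
        module
      · simp [tripleCoeff, huv, huw]
    · refine ⟨tripleCoeff v w u (1 / 2) ((1 - s) / 2) (s / 2),
        T.K.tripleCoeff_mem_conicCoeffs hu one_half_pos hs1 hs2, ?_,
        Or.inr ⟨hs0, u, Or.inr hℓu, hpos, support_tripleCoeff _ _ _ one_half_pos hs1 hs2, ?_⟩⟩
      · rw [linearCombination_tripleCoeff, Crossing.mid_eq, Crossing.mid_eq, hf,
          AffineMap.lineMap_apply_module]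
        module
      · simp [tripleCoeff, huv, huw]

theorem eq_of_pair_subset {v w v' w' : EuclideanSpace ℝ (Fin 3)} (hv : ℓ v = 1) (hw : ℓ w = -1)
    (hv' : ℓ v' = 1) (hw' : ℓ w' = -1)
    (h : ({v, w} : Finset (EuclideanSpace ℝ (Fin 3))) ⊆ {v', w'}) : v = v' ∧ w = w' := by
  have hv1 := h (Finset.mem_insert_self v _)
  have hw1 := h (Finset.mem_insert_of_mem (Finset.mem_singleton_self w))
  simp only [Finset.mem_insert, Finset.mem_singleton] at hv1 hw1
  constructor
  · rcases hv1 with rfl | rfl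
    · rfl
    · linarith
  · rcases hw1 with rfl | rfl
    · linarith
    · rfl

theorem eq_of_triple_subset {v w u v' w' u' : EuclideanSpace ℝ (Fin 3)} (hv : ℓ v = 1)
    (hw : ℓ w = -1) (hv' : ℓ v' = 1) (hw' : ℓ w' = -1) (hpos : 0 < tripleProduct v w u)
    (hpos' : 0 < tripleProduct v' w' u')
    (h : ({v, w, u} : Finset (EuclideanSpace ℝ (Fin 3))) ⊆ {v', w', u'}) :
    v = v' ∧ w = w' ∧ u = u' := by
  have hv1 := h (show v ∈ _ by simp)
  have hw1 := h (show w ∈ _ by simp)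
  have hu1 := h (show u ∈ _ by simp)
  simp only [Finset.mem_insert, Finset.mem_singleton] at hv1 hw1 hu1
  have hleft := tripleProduct_self_left v w
  have hright := tripleProduct_self_right v w
  have hswap : tripleProduct u' w' v' = -tripleProduct v' w' u' := by
    rw [← tripleProduct_rotate, tripleProduct_swap_left]
  have hswap' := tripleProduct_swap_right v' w' u'
  rcases hv1 with rfl | rfl | rfl <;> rcases hw1 with rfl | rfl | rfl <;>
    rcases hu1 with rfl | rfl | rfl <;>
    first | exact ⟨rfl, rfl, rfl⟩ | linarith

theorem Crossing.IsNext.lineMap_injective {e e' f f' : Crossing T ℓ} (h : e.IsNext f)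
    (h' : e'.IsNext f') {s t : ℝ} (hs : s ∈ Set.Ico (0 : ℝ) 1) (ht : t ∈ Set.Ico (0 : ℝ) 1)
    (heq : (AffineMap.lineMap e.mid f.mid s : EuclideanSpace ℝ (Fin 3)) =
      AffineMap.lineMap e'.mid f'.mid t) : e = e' ∧ s = t := by
  obtain ⟨c, hc, hcx, hcase⟩ := h.exists_conicCoeffs hs
  obtain ⟨d, hd, hdx, hcase'⟩ := h'.exists_conicCoeffs ht
  obtain rfl := T.conicCoeffs_injOn hc hd (by rw [hcx, hdx, heq])
  obtain ⟨⟨v, w⟩, he, hv, hw⟩ := e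
  obtain ⟨⟨v', w'⟩, he', hv', hw'⟩ := e'
  dsimp only at *
  rcases hcase with ⟨rfl, hsupp⟩ | ⟨hs0, u, hℓu, hpos, hsupp, hcu⟩ <;>
    rcases hcase' with ⟨rfl, hsupp'⟩ | ⟨ht0, u', hℓu', hpos', hsupp', hcu'⟩ <;>
    rw [hsupp] at hsupp'
  · obtain ⟨rfl, rfl⟩ := eq_of_pair_subset hv hw hv' hw' hsupp'.le
    exact ⟨rfl, rfl⟩
  · obtain ⟨rfl, rfl⟩ := eq_of_pair_subset hv' hw' hv hw
      ((Finset.insert_subset_insert _ (by simp)).trans hsupp'.ge)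
    have hu : u' ∈ ({v', w'} : Finset _) := hsupp' ▸ by simp
    rcases Finset.mem_insert.1 hu with rfl | hu
    · exact absurd (tripleProduct_self_left _ _) hpos'.ne'
    · exact absurd (Finset.mem_singleton.1 hu ▸ tripleProduct_self_right _ _) hpos'.ne'
  · obtain ⟨rfl, rfl⟩ := eq_of_pair_subset hv hw hv' hw'
      ((Finset.insert_subset_insert _ (by simp)).trans hsupp'.le)
    have hu : u ∈ ({v, w} : Finset _) := hsupp' ▸ by simp
    rcases Finset.mem_insert.1 hu with rfl | hu
    · exact absurd (tripleProduct_self_left _ _) hpos.ne'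
    · exact absurd (Finset.mem_singleton.1 hu ▸ tripleProduct_self_right _ _) hpos.ne'
  · obtain ⟨rfl, rfl, rfl⟩ := eq_of_triple_subset hv hw hv' hw' hpos hpos' hsupp'.le
    exact ⟨rfl, by linarith⟩

theorem subset_mem_faces {s t : Finset (EuclideanSpace ℝ (Fin 3))} (hs : s ∈ T.K.faces)
    {v : EuclideanSpace ℝ (Fin 3)} (h : insert v t ⊆ s) : insert v t ∈ T.K.faces :=
  T.K.down_closed hs h (Finset.insert_nonempty v t)

/-- The value of the simplicial extension in barycentric coordinates. -/
theorem simplicialExtension_apply (hL : IsSimplicialExtension T ℓ L)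
    {c : EuclideanSpace ℝ (Fin 3) →₀ ℝ} (hc : c ∈ T.K.conicCoeffs)
    (h1 : ∑ z ∈ c.support, c z = 1) :
    L (linearCombination ℝ id c) = ∑ z ∈ c.support, c z * ℓ z := by
  obtain ⟨A, hA⟩ := hL.2 _ hc.2
  have hAz : ∀ z, A z = A.linear z + A 0 := fun z => congrFun A.decomp z
  calc L (linearCombination ℝ id c)
      = ∑ z ∈ c.support, c z * A.linear z + (∑ z ∈ c.support, c z) * A 0 := by
        rw [hA _ (T.K.linearCombination_mem_convexHull hc h1), hAz, h1, one_mul,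
          linearCombination_apply, Finsupp.sum, map_sum]
        simp
    _ = ∑ z ∈ c.support, c z * ℓ z := by
        rw [Finset.sum_mul, ← Finset.sum_add_distrib]
        refine Finset.sum_congr rfl fun z hz => ?_
        rw [← mul_add, ← hAz, ← hA z (subset_convexHull ℝ _ hz), hL.1 z (mem_vertices hc.2 hz)]

theorem Crossing.IsNext.segment_subset (hL : IsSimplicialExtension T ℓ L) {e f : Crossing T ℓ}
    (h : e.IsNext f) : segment ℝ e.mid f.mid ⊆ {x ∈ T.K.space | L x = 0} := by
  obtain ⟨u, hu, -, hf⟩ := h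
  obtain ⟨A, hA⟩ := hL.2 _ hu
  set s : Finset (EuclideanSpace ℝ (Fin 3)) := {e.1.1, e.1.2, u} with hs
  have hmid : ∀ g : Crossing T ℓ, g.1.1 ∈ s → g.1.2 ∈ s →
      g.mid ∈ convexHull ℝ (s : Set (EuclideanSpace ℝ (Fin 3))) ∧ A g.mid = 0 := by
    intro g h1 h2
    have h1' := subset_convexHull ℝ (s : Set (EuclideanSpace ℝ (Fin 3))) h1
    have h2' := subset_convexHull ℝ (s : Set (EuclideanSpace ℝ (Fin 3))) h2
    refine ⟨(convex_convexHull ℝ _).midpoint_mem h1' h2', ?_⟩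
    rw [Crossing.mid, A.map_midpoint, ← hA _ h1', ← hA _ h2', hL.1 _ (mem_vertices hu h1),
      hL.1 _ (mem_vertices hu h2), g.2.2.1, g.2.2.2, midpoint_self_neg]
  obtain ⟨he, he0⟩ := hmid e (by simp [hs]) (by simp [hs])
  obtain ⟨hf, hf0⟩ := hmid f (by rcases hf with ⟨-, hf⟩ | ⟨-, hf⟩ <;> simp [hs, hf])
    (by rcases hf with ⟨-, hf⟩ | ⟨-, hf⟩ <;> simp [hs, hf])
  intro x hx
  have hxs := (convex_convexHull ℝ _).segment_subset he hf hx
  refine ⟨T.K.convexHull_subset_space hu hxs, ?_⟩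
  rw [hA x hxs]
  rw [segment_eq_image_lineMap] at hx
  obtain ⟨r, -, rfl⟩ := hx
  rw [A.apply_lineMap, he0, hf0, AffineMap.lineMap_same_apply]

theorem exists_segment_of_two_pos {s : Finset (EuclideanSpace ℝ (Fin 3))} (hs : s ∈ T.K.faces)
    {a b w : EuclideanSpace ℝ (Fin 3)} (ha : a ∈ s) (hb : b ∈ s) (hw : w ∈ s) (hab : a ≠ b)
    (hℓa : ℓ a = 1) (hℓb : ℓ b = 1) (hℓw : ℓ w = -1) {α β : ℝ} (hα : 0 ≤ α) (hβ : 0 ≤ β)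
    (hαβ : α + β = 1 / 2) :
    ∃ e f : Crossing T ℓ, e.IsNext f ∧ α • a + β • b + (1 / 2 : ℝ) • w ∈ segment ℝ e.mid f.mid := by
  have haw : a ≠ w := by
    rintro rfl
    linarith
  have hbw : b ≠ w := by
    rintro rfl
    linarith
  have hface : ∀ x ∈ s, ∀ y ∈ s, ({x, w, y} : Finset _) ∈ T.K.faces := fun x hx y hy =>
    subset_mem_faces hs (by simp [Finset.insert_subset_iff, *])
  have hface' : ∀ x ∈ s, ({x, w} : Finset _) ∈ T.K.faces := fun x hx =>
    subset_mem_faces hs (by simp [Finset.insert_subset_iff, *])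
  have hβα : β = 1 / 2 - α := by linarith
  rcases (tripleProduct_ne_zero (hface a ha b hb) haw hab hbw.symm).lt_or_gt with h | h
  · refine ⟨⟨(b, w), hface' b hb, hℓb, hℓw⟩, ⟨(a, w), hface' a ha, hℓa, hℓw⟩,
      ⟨a, hface b hb a ha, ?_, Or.inl ⟨hℓa, rfl⟩⟩, 2 * β, 2 * α, by linarith, by linarith,
      by linarith, ?_⟩
    · dsimp only
      rw [← tripleProduct_rotate, tripleProduct_swap_left]
      linarith
    · rw [Crossing.mid_eq, Crossing.mid_eq, hβα]
      module
  · refine ⟨⟨(a, w), hface' a ha, hℓa, hℓw⟩, ⟨(b, w), hface' b hb, hℓb, hℓw⟩,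
      ⟨b, hface a ha b hb, h, Or.inl ⟨hℓb, rfl⟩⟩, 2 * α, 2 * β, by linarith, by linarith,
      by linarith, ?_⟩
    rw [Crossing.mid_eq, Crossing.mid_eq, hβα]
    module

theorem exists_segment_of_two_neg {s : Finset (EuclideanSpace ℝ (Fin 3))} (hs : s ∈ T.K.faces)
    {a b v : EuclideanSpace ℝ (Fin 3)} (ha : a ∈ s) (hb : b ∈ s) (hv : v ∈ s) (hab : a ≠ b)
    (hℓa : ℓ a = -1) (hℓb : ℓ b = -1) (hℓv : ℓ v = 1) {α β : ℝ} (hα : 0 ≤ α) (hβ : 0 ≤ β)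
    (hαβ : α + β = 1 / 2) :
    ∃ e f : Crossing T ℓ, e.IsNext f ∧ α • a + β • b + (1 / 2 : ℝ) • v ∈ segment ℝ e.mid f.mid := by
  have hva : v ≠ a := by
    rintro rfl
    linarith
  have hvb : v ≠ b := by
    rintro rfl
    linarith
  have hface : ∀ x ∈ s, ∀ y ∈ s, ({v, x, y} : Finset _) ∈ T.K.faces := fun x hx y hy =>
    subset_mem_faces hs (by simp [Finset.insert_subset_iff, *])
  have hface' : ∀ x ∈ s, ({v, x} : Finset _) ∈ T.K.faces := fun x hx =>
    subset_mem_faces hs (by simp [Finset.insert_subset_iff, *])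
  have hβα : β = 1 / 2 - α := by linarith
  rcases (tripleProduct_ne_zero (hface a ha b hb) hva hvb hab).lt_or_gt with h | h
  · refine ⟨⟨(v, b), hface' b hb, hℓv, hℓb⟩, ⟨(v, a), hface' a ha, hℓv, hℓa⟩,
      ⟨a, hface b hb a ha, ?_, Or.inr ⟨hℓa, rfl⟩⟩, 2 * β, 2 * α, by linarith, by linarith,
      by linarith, ?_⟩
    · dsimp only
      rw [tripleProduct_swap_right]
      linarith
    · rw [Crossing.mid_eq, Crossing.mid_eq, hβα]
      module
  · refine ⟨⟨(v, a), hface' a ha, hℓv, hℓa⟩, ⟨(v, b), hface' b hb, hℓv, hℓb⟩,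
      ⟨b, hface a ha b hb, h, Or.inr ⟨hℓb, rfl⟩⟩, 2 * α, 2 * β, by linarith, by linarith,
      by linarith, ?_⟩
    rw [Crossing.mid_eq, Crossing.mid_eq, hβα]
    module

theorem exists_segment_of_pair (hℓ : IsGenTuckerLabelling T ℓ)
    {v w : EuclideanSpace ℝ (Fin 3)} (h : {v, w} ∈ T.K.faces) (hv : ℓ v = 1) (hw : ℓ w = -1) :
    ∃ e f : Crossing T ℓ, e.IsNext f ∧
      (1 / 2 : ℝ) • v + (1 / 2 : ℝ) • w ∈ segment ℝ e.mid f.mid := by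
  obtain ⟨f, hf⟩ := Crossing.exists_isNext hℓ ⟨(v, w), h, hv, hw⟩
  refine ⟨_, f, hf, ?_⟩
  rw [← Crossing.mid_eq ⟨(v, w), h, hv, hw⟩]
  exact left_mem_segment ℝ _ _

theorem exists_segment_of_zero (hℓ : IsGenTuckerLabelling T ℓ) (hL : IsSimplicialExtension T ℓ L)
    {x : EuclideanSpace ℝ (Fin 3)} (hx : x ∈ T.K.space) (h0 : L x = 0) :
    ∃ e f : Crossing T ℓ, e.IsNext f ∧ x ∈ segment ℝ e.mid f.mid := by
  obtain ⟨t, ht, hxt⟩ := T.K.mem_space_iff.1 hx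
  obtain ⟨c, hc, -, hc1, rfl⟩ := T.K.exists_conicCoeffs_of_mem_convexHull ht hxt
  rw [simplicialExtension_apply hL hc hc1] at h0
  rw [linearCombination_apply, Finsupp.sum]
  have hlab : ∀ z ∈ c.support, ℓ z = 1 ∨ ℓ z = -1 := fun z hz => hℓ.1 z (mem_vertices hc.2 hz)
  have hcpos : ∀ z ∈ c.support, 0 < c z := fun z hz =>
    (hc.1 z).lt_of_ne' (mem_support_iff.1 hz)
  have hcard := T.card_le_three hc.2
  have hcard0 := (T.K.nonempty_of_mem_faces hc.2).card_pos
  have hs := hc.2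
  generalize c.support = s at *
  obtain h | h | h : s.card = 1 ∨ s.card = 2 ∨ s.card = 3 := by omega
  · obtain ⟨a, rfl⟩ := Finset.card_eq_one.1 h
    rw [Finset.sum_singleton] at h0 hc1
    rcases hlab a (by simp) with ha | ha <;> rw [ha, hc1] at h0 <;> norm_num at h0
  · obtain ⟨a, b, hab, rfl⟩ := Finset.card_eq_two.1 h
    rw [Finset.sum_pair hab] at h0 hc1 ⊢
    rcases hlab a (by simp) with ha | ha <;> rcases hlab b (by simp) with hb | hb <;>
      rw [ha, hb] at h0
    · linarith
    · rw [show c a = 1 / 2 by linarith, show c b = 1 / 2 by linarith]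
      exact exists_segment_of_pair hℓ hs ha hb
    · rw [show c a = 1 / 2 by linarith, show c b = 1 / 2 by linarith, add_comm]
      exact exists_segment_of_pair hℓ (by rwa [Finset.pair_comm]) hb ha
    · linarith
  · obtain ⟨a, b, d, hab, had, hbd, rfl⟩ := Finset.card_eq_three.1 h
    have hda : d ≠ a := had.symm
    simp only [Finset.sum_insert (show a ∉ ({b, d} : Finset _) by simp [hab, had]),
      Finset.sum_pair hbd, id, ← add_assoc] at h0 hc1 ⊢
    have ha0 := hcpos a (by simp)
    have hb0 := hcpos b (by simp)
    have hd0 := hcpos d (by simp)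
    have hmem : a ∈ ({a, b, d} : Finset _) ∧ b ∈ ({a, b, d} : Finset _) ∧
      d ∈ ({a, b, d} : Finset _) := by simp
    obtain ⟨hma, hmb, hmd⟩ := hmem
    have hrot : c a • a + c b • b + c d • d = c b • b + c d • d + c a • a := by abel
    have hrot' : c a • a + c b • b + c d • d = c d • d + c a • a + c b • b := by abel
    rcases hlab a hma with ha | ha <;> rcases hlab b hmb with hb | hb <;>
      rcases hlab d hmd with hd | hd <;> rw [ha, hb, hd] at h0
    · linarith
    · rw [show c d = 1 / 2 by linarith]
      exact exists_segment_of_two_pos hs hma hmb hmd hab ha hb hd ha0.le hb0.le (by linarith)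
    · rw [hrot', show c b = 1 / 2 by linarith]
      exact exists_segment_of_two_pos hs hmd hma hmb hda hd ha hb hd0.le ha0.le (by linarith)
    · rw [hrot, show c a = 1 / 2 by linarith]
      exact exists_segment_of_two_neg hs hmb hmd hma hbd hb hd ha hb0.le hd0.le (by linarith)
    · rw [hrot, show c a = 1 / 2 by linarith]
      exact exists_segment_of_two_pos hs hmb hmd hma hbd hb hd ha hb0.le hd0.le (by linarith)
    · rw [hrot', show c b = 1 / 2 by linarith]
      exact exists_segment_of_two_neg hs hmd hma hmb hda hd ha hb hd0.le ha0.le (by linarith)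
    · rw [show c d = 1 / 2 by linarith]
      exact exists_segment_of_two_neg hs hma hmb hmd hab ha hb hd ha0.le hb0.le (by linarith)
    · linarith

theorem eq_midpoint_of_zero (hℓ : IsGenTuckerLabelling T ℓ) (hL : IsSimplicialExtension T ℓ L)
    {s : Finset (EuclideanSpace ℝ (Fin 3))} (hs : s ∈ T.K.faces) (hcard : s.card = 2)
    {x : EuclideanSpace ℝ (Fin 3)}
    (hx : x ∈ convexHull ℝ (s : Set (EuclideanSpace ℝ (Fin 3)))) (h0 : L x = 0) :
    ∃ v ∈ s, ∃ w ∈ s, ℓ v ≠ ℓ w ∧ x = midpoint ℝ v w := by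
  obtain ⟨A, hA⟩ := hL.2 s hs
  obtain ⟨a, b, hab, rfl⟩ := Finset.card_eq_two.1 hcard
  have hAv : ∀ z ∈ ({a, b} : Finset _), A z = ℓ z := fun z hz => by
    rw [← hA z (subset_convexHull ℝ _ hz), hL.1 z (mem_vertices hs hz)]
  rw [hA x hx] at h0
  rw [Finset.coe_pair, convexHull_pair, segment_eq_image_lineMap] at hx
  obtain ⟨r, -, rfl⟩ := hx
  rw [A.apply_lineMap, hAv a (by simp), hAv b (by simp), AffineMap.lineMap_apply_module,
    smul_eq_mul, smul_eq_mul] at h0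
  have hne : ℓ a ≠ ℓ b := fun h => by
    rcases hℓ.1 a (mem_vertices hs (by simp)) with ha | ha <;> rw [← h, ha] at h0 <;> linarith
  refine ⟨a, by simp, b, by simp, hne, ?_⟩
  have hr : r = ⅟2 := by
    rw [invOf_eq_inv]
    rcases hℓ.1 a (mem_vertices hs (by simp)) with ha | ha <;>
      rcases hℓ.1 b (mem_vertices hs (by simp)) with hb | hb <;> rw [ha, hb] at h0 hne <;>
      first | exact absurd rfl hne | linarith
  rw [hr]
  rfl

end SymmetricSphereTriangulation

section ClosedPolygons

open Function Set

variable {E : Type*} [AddCommGroup E] [Module ℝ E]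

/-- The piecewise linear curve through a sequence of points. -/
noncomputable def polygonalCurve (q : ℤ → E) (t : ℝ) : E :=
  AffineMap.lineMap (q ⌊t⌋) (q (⌊t⌋ + 1)) (Int.fract t)

theorem polygonalCurve_eq (q : ℤ → E) {k : ℤ} {t : ℝ} (ht : t ∈ Icc (k : ℝ) (k + 1)) :
    polygonalCurve q t = AffineMap.lineMap (q k) (q (k + 1)) (t - k) := by
  rcases ht.2.lt_or_eq with h | rfl
  · have hk : ⌊t⌋ = k := Int.floor_eq_iff.2 ⟨ht.1, h⟩
    rw [polygonalCurve, Int.fract, hk]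
  · have hk : ⌊(k : ℝ) + 1⌋ = k + 1 := by simp
    rw [polygonalCurve, Int.fract, hk]
    simp

theorem continuous_polygonalCurve [TopologicalSpace E] [IsTopologicalAddGroup E]
    [ContinuousSMul ℝ E] (q : ℤ → E) : Continuous (polygonalCurve q) := by
  have hcont : ∀ k : ℤ, ContinuousOn (polygonalCurve q) (Icc (k : ℝ) (k + 1)) := fun k =>
    ContinuousOn.congr (f := fun t => AffineMap.lineMap (q k) (q (k + 1)) (t - (k : ℝ)))
      (by
        simp only [AffineMap.lineMap_apply_module]
        fun_prop)
      fun t ht => polygonalCurve_eq q ht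
  refine continuous_iff_continuousAt.2 fun t => continuousAt_iff_continuous_left_right.2 ⟨?_, ?_⟩
  · have h1 : ((⌈t⌉ - 1 : ℤ) : ℝ) < t := by
      push_cast
      linarith [Int.ceil_lt_add_one t]
    have h2 : t ≤ ((⌈t⌉ - 1 : ℤ) : ℝ) + 1 := by
      push_cast
      linarith [Int.le_ceil t]
    refine (hcont (⌈t⌉ - 1) t ⟨h1.le, h2⟩).mono_of_mem_nhdsWithin ?_
    exact Filter.mem_of_superset (Icc_mem_nhdsLE h1) (Icc_subset_Icc_right h2)
  · have h1 := Int.floor_le t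
    have h2 := Int.lt_floor_add_one t
    refine (hcont ⌊t⌋ t ⟨h1, h2.le⟩).mono_of_mem_nhdsWithin ?_
    exact Filter.mem_of_superset (Icc_mem_nhdsGE h2) (Icc_subset_Icc_left h1)

theorem range_polygonalCurve (q : ℤ → E) :
    range (polygonalCurve q) = ⋃ k, segment ℝ (q k) (q (k + 1)) := by
  ext x
  simp only [mem_range, mem_iUnion, segment_eq_image_lineMap, mem_image]
  constructor
  · rintro ⟨t, rfl⟩
    exact ⟨⌊t⌋, Int.fract t, ⟨Int.fract_nonneg t, (Int.fract_lt_one t).le⟩, rfl⟩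
  · rintro ⟨k, s, hs, rfl⟩
    refine ⟨k + s, ?_⟩
    rw [polygonalCurve_eq q (k := k) ⟨by linarith [hs.1], by linarith [hs.2]⟩,
      add_sub_cancel_left]

variable {α : Type*}

/-- The polygon through the images of the points in the orbit of `a` under `σ`. -/
def orbitPolygon (σ : Equiv.Perm α) (m : α → E) (a : α) : Set E :=
  ⋃ k : ℤ, segment ℝ (m ((σ ^ k) a)) (m ((σ ^ (k + 1)) a))

/-- The segments from each `m a` to `m (σ a)` are disjoint except for the forced common
endpoints. -/
def EmbedsSegments (σ : Equiv.Perm α) (m : α → E) : Prop :=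
  ∀ a b : α, ∀ s ∈ Ico (0 : ℝ) 1, ∀ t ∈ Ico (0 : ℝ) 1,
    AffineMap.lineMap (m a) (m (σ a)) s = AffineMap.lineMap (m b) (m (σ b)) t → a = b ∧ s = t

theorem mem_orbitPolygon_iff {σ : Equiv.Perm α} {m : α → E} {a : α} {x : E} :
    x ∈ orbitPolygon σ m a ↔
      ∃ k : ℤ, ∃ s ∈ Ico (0 : ℝ) 1,
        x = AffineMap.lineMap (m ((σ ^ k) a)) (m (σ ((σ ^ k) a))) s := by
  have hsucc : ∀ k : ℤ, σ ((σ ^ k) a) = (σ ^ (k + 1)) a := fun k => by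
    rw [add_comm, zpow_add, zpow_one, Equiv.Perm.mul_apply]
  rw [orbitPolygon, ← range_polygonalCurve fun k : ℤ => m ((σ ^ k) a)]
  constructor
  · rintro ⟨t, rfl⟩
    exact ⟨⌊t⌋, Int.fract t, ⟨Int.fract_nonneg t, Int.fract_lt_one t⟩, by
      rw [hsucc, polygonalCurve]⟩
  · rintro ⟨k, s, hs, rfl⟩
    refine ⟨k + s, ?_⟩
    rw [polygonalCurve_eq _ (k := k) ⟨by linarith [hs.1], by linarith [hs.2]⟩,
      add_sub_cancel_left, hsucc]

theorem disjoint_orbitPolygon {σ : Equiv.Perm α} {m : α → E} (h : EmbedsSegments σ m) {a b : α}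
    (hab : ¬ σ.SameCycle a b) : Disjoint (orbitPolygon σ m a) (orbitPolygon σ m b) := by
  refine Set.disjoint_left.2 fun x hxa hxb => hab ?_
  obtain ⟨k, s, hs, rfl⟩ := mem_orbitPolygon_iff.1 hxa
  obtain ⟨l, t, ht, hx⟩ := mem_orbitPolygon_iff.1 hxb
  have := (h _ _ s hs t ht hx).1
  exact ⟨-l + k, by rw [zpow_add, Equiv.Perm.mul_apply, this, ← Equiv.Perm.mul_apply, ← zpow_add,
    neg_add_cancel, zpow_zero, Equiv.Perm.one_apply]⟩

theorem Equiv.Perm.exists_period [Finite α] (σ : Equiv.Perm α) (a : α) :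
    ∃ n : ℕ, 0 < n ∧ ∀ k l : ℤ, (σ ^ k) a = (σ ^ l) a ↔ (n : ℤ) ∣ k - l := by
  refine ⟨minimalPeriod (σ • ·) a, ?_, fun k l => ?_⟩
  · exact minimalPeriod_pos_of_mem_periodicPts
      (σ.injective.mem_periodicPts a)
  · rw [← MulAction.zpow_smul_eq_iff_minimalPeriod_dvd, sub_eq_neg_add, zpow_add, zpow_neg,
      mul_smul, inv_smul_eq_iff]
    rfl

theorem exists_circle_of_orbitPolygon [Finite α] [TopologicalSpace E] [IsTopologicalAddGroup E]
    [ContinuousSMul ℝ E] {σ : Equiv.Perm α} {m : α → E} (h : EmbedsSegments σ m)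
    (a : α) : ∃ f : Circle → E, Continuous f ∧ Injective f ∧ range f = orbitPolygon σ m a := by
  obtain ⟨n, hn, hper⟩ := σ.exists_period a
  set q : ℤ → E := fun k => m ((σ ^ k) a) with hq
  have hqper : ∀ k l : ℤ, (n : ℤ) ∣ k - l → q k = q l := fun k l hkl =>
    congrArg m ((hper k l).2 hkl)
  have hperiodic : Periodic (polygonalCurve q) (n : ℝ) := fun t => by
    have h1 : ⌊t + (n : ℝ)⌋ = ⌊t⌋ + n := Int.floor_add_natCast t n
    rw [polygonalCurve, polygonalCurve, Int.fract_add_natCast, h1, hqper (⌊t⌋ + n) ⌊t⌋ (by simp),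
      hqper (⌊t⌋ + n + 1) (⌊t⌋ + 1) (by simp)]
  have hcoe : ∀ t : ℝ, hperiodic.lift (t : AddCircle (n : ℝ)) = polygonalCurve q t :=
    fun t => hperiodic.lift_coe t
  have hsucc : ∀ k : ℤ, q (k + 1) = m (σ ((σ ^ k) a)) := fun k => by
    rw [hq, add_comm]
    simp only [zpow_add, zpow_one, Equiv.Perm.mul_apply]
  have hinj : Injective (hperiodic.lift : AddCircle (n : ℝ) → E) := by
    intro x y
    induction x using QuotientAddGroup.induction_on with | H s => ?_
    induction y using QuotientAddGroup.induction_on with | H t => ?_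
    intro hst
    erw [hcoe, hcoe] at hst
    rw [polygonalCurve, polygonalCurve, hsucc, hsucc] at hst
    obtain ⟨h1, h2⟩ := h _ _ _ ⟨Int.fract_nonneg s, Int.fract_lt_one s⟩ _
      ⟨Int.fract_nonneg t, Int.fract_lt_one t⟩ hst
    obtain ⟨k, hk⟩ := (hper _ _).1 h1
    rw [← sub_eq_zero]
    refine (AddCircle.coe_eq_zero_iff (n : ℝ) (x := s - t)).2 ⟨k, ?_⟩
    have hk' : (⌊s⌋ : ℝ) - ⌊t⌋ = n * k := by exact_mod_cast hk
    rw [zsmul_eq_mul, mul_comm, ← hk']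
    linarith [Int.floor_add_fract s, Int.floor_add_fract t]
  have hcont : Continuous (hperiodic.lift : AddCircle (n : ℝ) → E) :=
    continuous_coinduced_dom.2 (continuous_polygonalCurve q)
  have hn' : (n : ℝ) ≠ 0 := by exact_mod_cast hn.ne'
  refine ⟨hperiodic.lift ∘ (AddCircle.homeomorphCircle hn').symm,
    hcont.comp (Homeomorph.continuous _), hinj.comp (Homeomorph.injective _), ?_⟩
  rw [(Homeomorph.surjective _).range_comp, orbitPolygon, ← range_polygonalCurve q]
  ext x
  constructor
  · rintro ⟨y, rfl⟩
    induction y using QuotientAddGroup.induction_on with | H t => ?_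
    exact ⟨t, (hcoe t).symm⟩
  · rintro ⟨t, rfl⟩
    exact ⟨t, hcoe t⟩

theorem exists_cyclic_vertices_of_orbitPolygon [Finite α] (σ : Equiv.Perm α) (m : α → E) (a : α) :
    ∃ (n : ℕ) (_ : 0 < n) (p : ZMod n → E),
      orbitPolygon σ m a = ⋃ i, segment ℝ (p i) (p (i + 1)) := by
  obtain ⟨n, hn, hper⟩ := σ.exists_period a
  have hp : ∀ k l : ℤ, (k : ZMod n) = l → (σ ^ k) a = (σ ^ l) a := fun k l hkl =>
    (hper k l).2 ((ZMod.intCast_eq_intCast_iff_dvd_sub l k n).1 hkl.symm)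
  refine ⟨n, hn, fun i => m ((σ ^ (i.cast : ℤ)) a), ?_⟩
  have hsucc : ∀ i : ZMod n, (σ ^ ((i + 1).cast : ℤ)) a = (σ ^ ((i.cast : ℤ) + 1)) a := fun i =>
    hp _ _ (by simp)
  ext x
  simp only [orbitPolygon, mem_iUnion, hsucc]
  constructor
  · rintro ⟨k, hk⟩
    refine ⟨k, ?_⟩
    rwa [hp ((k : ZMod n).cast : ℤ) k (by simp), hp (((k : ZMod n).cast : ℤ) + 1) (k + 1) (by simp)]
  · rintro ⟨i, hi⟩
    exact ⟨_, hi⟩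

theorem exists_disjoint_orbitPolygons [Finite α] {σ : Equiv.Perm α} {m : α → E}
    (h : EmbedsSegments σ m) :
    ∃ (k : ℕ) (r : Fin k → α), Pairwise (Disjoint on fun i => orbitPolygon σ m (r i)) ∧
      ⋃ i, orbitPolygon σ m (r i) = ⋃ a, segment ℝ (m a) (m (σ a)) := by
  obtain ⟨k, ⟨ε⟩⟩ := Finite.exists_equiv_fin (Quotient (Equiv.Perm.SameCycle.setoid σ))
  refine ⟨k, fun i => (ε.symm i).out, fun i j hij => disjoint_orbitPolygon h fun hs => hij ?_, ?_⟩
  · exact ε.symm.injective (Quotient.out_equiv_out.1 hs)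
  · refine subset_antisymm (iUnion_subset fun i => iUnion_subset fun l => ?_)
      (iUnion_subset fun a => ?_)
    · rw [add_comm, zpow_add, zpow_one, Equiv.Perm.mul_apply]
      exact subset_iUnion (fun a => segment ℝ (m a) (m (σ a))) _
    · obtain ⟨l, hl⟩ : σ.SameCycle (ε.symm (ε ⟦a⟧)).out a := by
        rw [Equiv.symm_apply_apply]
        exact Quotient.mk_out (s := Equiv.Perm.SameCycle.setoid σ) a
      refine subset_iUnion_of_subset (ε ⟦a⟧) (subset_iUnion_of_subset l ?_)
      rw [add_comm, zpow_add, zpow_one, Equiv.Perm.mul_apply, hl]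

end ClosedPolygons

/-- The zero set of the simplicial extension of a generalized Tucker labelling is a finite
disjoint union of polygonal simple closed paths, each meeting the edges of the
triangulation only in midpoints of edges whose endpoints carry opposite labels. -/
theorem zero_set_is_union_of_polygonal_paths (T : SymmetricSphereTriangulation)
    (ℓ L : EuclideanSpace ℝ (Fin 3) → ℝ)
    (hℓ : IsGenTuckerLabelling T ℓ) (hL : IsSimplicialExtension T ℓ L) :
    ∃ (m : ℕ) (P : Fin m → Set (EuclideanSpace ℝ (Fin 3))),
      (∀ i, IsPolygonalSimpleClosedPath (P i)) ∧
      Pairwise (Function.onFun Disjoint P) ∧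
      (⋃ i, P i) = {x ∈ T.K.space | L x = 0} ∧
      (∀ i, ∀ s ∈ T.K.faces, s.card = 2 →
        ∀ x ∈ P i ∩ convexHull ℝ (s : Set (EuclideanSpace ℝ (Fin 3))),
          ∃ v ∈ s, ∃ w ∈ s, ℓ v ≠ ℓ w ∧ x = midpoint ℝ v w) := by
  choose next hnext using SymmetricSphereTriangulation.Crossing.exists_isNext hℓ
  set σ : Equiv.Perm (T.Crossing ℓ) := Equiv.ofBijective next
    (Finite.injective_iff_bijective.1 fun a b hab => (hnext a).left_unique (hab ▸ hnext b))
  have hσ : EmbedsSegments σ SymmetricSphereTriangulation.Crossing.mid := fun a b s hs t ht h =>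
    (hnext a).lineMap_injective (hnext b) hs ht h
  have hzero : ⋃ e, segment ℝ e.mid (σ e).mid = {x ∈ T.K.space | L x = 0} := by
    refine Set.Subset.antisymm (Set.iUnion_subset fun e => (hnext e).segment_subset hL) ?_
    rintro x ⟨hx, h0⟩
    obtain ⟨e, f, hef, hxe⟩ := SymmetricSphereTriangulation.exists_segment_of_zero hℓ hL hx h0
    rw [hef.right_unique (hnext e)] at hxe
    exact Set.mem_iUnion.2 ⟨e, hxe⟩
  obtain ⟨m, r, hdisj, hunion⟩ := exists_disjoint_orbitPolygons hσ
  rw [hzero] at hunion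
  refine ⟨m, _, fun i => ⟨exists_circle_of_orbitPolygon hσ _,
    exists_cyclic_vertices_of_orbitPolygon σ _ _⟩, hdisj, hunion, ?_⟩
  rintro i s hs hcard x ⟨hxi, hxs⟩
  exact SymmetricSphereTriangulation.eq_midpoint_of_zero hℓ hL hs hcard hxs
    (hunion.subset (Set.mem_iUnion.2 ⟨i, hxi⟩)).2
end

section
/- Assume that for every generalized Tucker labelling of every finite symmetric triangulation of S² by {±1} there exists an antipodally invariant polygonal simple closed path in the zero set of the simplicial extension. Then for every smooth odd function g : S² → ℝ with 0 as a regular value, there exists a simple closed curve in g⁻¹({0}) invariant under the antipodal map. -/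
open scoped Manifold

section

open Set Filter Topology

section IntegralCurves

variable {E : Type*} [NormedAddCommGroup E] [NormedSpace ℝ E]

theorem LipschitzWith.integralCurve_unique {v : E → E} {K : NNReal} (hv : LipschitzWith K v)
    {α β : ℝ → E} (hα : ∀ t, HasDerivAt α (v (α t)) t) (hβ : ∀ t, HasDerivAt β (v (β t)) t)
    {t₀ : ℝ} (h : α t₀ = β t₀) : α = β :=
  ODE_solution_unique_univ (v := fun _ => v) (s := fun _ => univ)
    (fun _ => hv.lipschitzOnWith) (fun t => ⟨hα t, trivial⟩) (fun t => ⟨hβ t, trivial⟩) h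

theorem LipschitzWith.exists_global_integralCurve [CompleteSpace E] {v : E → E} {K L : NNReal}
    (hv : LipschitzWith K v) (hL : ∀ x, ‖v x‖ ≤ L) (x : E) :
    ∃ γ : ℝ → E, γ 0 = x ∧ ∀ t, HasDerivAt γ (v (γ t)) t := by
  have loc : ∀ a : ℝ, ∃ γ : ℝ → E, γ 0 = x ∧
      (0 < a → ∀ t ∈ Ioo (-a) a, HasDerivAt γ (v (γ t)) t) := by
    intro a
    rcases le_or_gt a 0 with ha | ha
    · exact ⟨fun _ => x, rfl, fun h => absurd h ha.not_gt⟩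
    have hp : IsPicardLindelof (fun _ => v) (tmin := -a) (tmax := a)
        ⟨0, by constructor <;> linarith⟩ x (L * ⟨a, ha.le⟩) 0 L K := by
      refine IsPicardLindelof.of_time_independent (fun y _ => hL y) hv.lipschitzOnWith ?_
      simp only [sub_zero, zero_sub, neg_neg, max_self, NNReal.coe_zero]
      exact le_rfl
    obtain ⟨γ, h0, hγ⟩ := hp.exists_eq_forall_mem_Icc_hasDerivWithinAt₀
    exact ⟨γ, h0, fun _ t ht =>
      (hγ t (Ioo_subset_Icc_self ht)).hasDerivAt (Icc_mem_nhds ht.1 ht.2)⟩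
  choose γ h0 hγ using loc
  have agree : ∀ {a b : ℝ}, 0 < a → a ≤ b → EqOn (γ a) (γ b) (Ioo (-a) a) := by
    intro a b ha hab
    have ha0 : (0 : ℝ) ∈ Ioo (-a) a := ⟨by linarith, ha⟩
    refine ODE_solution_unique_of_mem_Ioo (v := fun _ => v) (s := fun _ => univ)
      (fun _ _ => hv.lipschitzOnWith) ha0 (fun t ht => ⟨hγ a ha t ht, trivial⟩)
      (fun t ht => ⟨hγ b (ha.trans_le hab) t ⟨by linarith [ht.1], by linarith [ht.2]⟩, trivial⟩)
      (by rw [h0, h0])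
  have ext_eq : ∀ {a t : ℝ}, 0 < a → t ∈ Ioo (-a) a → γ (|t| + 1) t = γ a t := by
    intro a t ha ht
    rcases le_total (|t| + 1) a with h | h
    · exact agree (by positivity) h (abs_lt.1 (lt_add_one _))
    · exact (agree ha h ht).symm
  refine ⟨fun t => γ (|t| + 1) t, h0 _, fun t => ?_⟩
  have ht : t ∈ Ioo (-(|t| + 1)) (|t| + 1) := abs_lt.1 (lt_add_one _)
  refine (hγ (|t| + 1) (by positivity) t ht).congr_of_eventuallyEq ?_
  filter_upwards [Ioo_mem_nhds ht.1 ht.2] with s hs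
  exact ext_eq (by positivity) hs

end IntegralCurves

section ClosedCurves

variable {X : Type*} [TopologicalSpace X] {γ : ℝ → X}

/-- The additive group of periods of a function on the line. -/
def periodSubgroup {X : Type*} (γ : ℝ → X) : AddSubgroup ℝ where
  carrier := {T | Function.Periodic γ T}
  zero_mem' := fun x => by simp
  add_mem' := fun h h' => h.add_period h'
  neg_mem' := fun h => h.neg

theorem isClosed_periodSubgroup [T2Space X] (hγ : Continuous γ) :
    IsClosed (periodSubgroup γ : Set ℝ) := by
  have : (periodSubgroup γ : Set ℝ) = ⋂ x, {T | γ (x + T) = γ x} := by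
    ext T; simp [periodSubgroup, Function.Periodic]
  rw [this]
  exact isClosed_iInter fun x => isClosed_eq (by fun_prop) continuous_const

/-- A nonconstant continuous curve which is periodic as soon as it meets itself is either
injective or runs through a simple closed curve. -/
theorem injective_or_exists_circle_param [T2Space X] (hγ : Continuous γ)
    (hself : ∀ s t, γ s = γ t → Function.Periodic γ (s - t)) (hconst : ∃ s t, γ s ≠ γ t) :
    Function.Injective γ ∨
      ∃ f : Circle → X, Continuous f ∧ Function.Injective f ∧ range f = range γ := by
  rcases (periodSubgroup γ).dense_or_cyclic with hd | ⟨a, ha⟩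
  · obtain ⟨s, t, hst⟩ := hconst
    have : s - t ∈ (periodSubgroup γ : Set ℝ) := by
      rw [← (isClosed_periodSubgroup hγ).closure_eq, hd.closure_eq]; trivial
    exact absurd (by simpa using this t) hst
  rw [← AddSubgroup.zmultiples_eq_closure] at ha
  have hmem : ∀ {T}, Function.Periodic γ T ↔ T ∈ AddSubgroup.zmultiples a := by
    intro T; rw [← ha]; rfl
  rcases eq_or_ne a 0 with rfl | ha0
  · left
    intro s t hst
    have := hmem.1 (hself s t hst)
    simpa [sub_eq_zero] using this
  right
  have hper : Function.Periodic γ a := hmem.2 (AddSubgroup.mem_zmultiples a)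
  have hlift : Continuous (hper.lift : AddCircle a → X) :=
    continuous_coinduced_dom.2 hγ
  refine ⟨hper.lift ∘ (AddCircle.homeomorphCircle ha0).symm,
    hlift.comp (Homeomorph.continuous _), Function.Injective.comp ?_ (Homeomorph.injective _), ?_⟩
  · intro x y
    induction x using QuotientAddGroup.induction_on with | H s => ?_
    induction y using QuotientAddGroup.induction_on with | H t => ?_
    intro h
    have := hmem.1 (hself t s h.symm)
    rw [QuotientAddGroup.eq]
    rwa [neg_add_eq_sub]
  · rw [EquivLike.range_comp]
    ext x
    constructor
    · rintro ⟨y, rfl⟩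
      induction y using QuotientAddGroup.induction_on with | H s => ?_
      exact ⟨s, rfl⟩
    · rintro ⟨s, rfl⟩
      exact ⟨(s : AddCircle a), rfl⟩

/-- An injective curve cannot have compact image if each of its short arcs is a neighbourhood
within the image. -/
theorem not_injective_of_isCompact_range (hc : IsCompact (range γ))
    (hnhds : ∀ t, γ '' Ioo (t - 1) (t + 1) ∈ 𝓝[range γ] γ t) : ¬ Function.Injective γ := by
  intro hinj
  have hU : ∀ x ∈ range γ, ∃ t, γ '' Ioo (t - 1) (t + 1) ∈ 𝓝[range γ] x := by
    rintro _ ⟨t, rfl⟩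
    exact ⟨t, hnhds t⟩
  choose! τ hτ using hU
  obtain ⟨F, -, hF⟩ :=
    hc.elim_nhdsWithin_subcover (fun x => γ '' Ioo (τ x - 1) (τ x + 1)) hτ
  obtain ⟨M, hM⟩ := (F.image τ).bddAbove
  obtain ⟨x, hx, s, hs, hsx⟩ : ∃ x ∈ F, ∃ s ∈ Ioo (τ x - 1) (τ x + 1), γ s = γ (M + 1) := by
    simpa using hF (mem_range_self (M + 1))
  have := hM (Finset.mem_coe.2 (Finset.mem_image_of_mem τ hx))
  rw [hinj hsx] at hs
  linarith [hs.2]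

end ClosedCurves

section BorsukUlam

theorem eq_of_continuous_of_exp_eq {A : Type*} [TopologicalSpace A] [PreconnectedSpace A]
    {q : A → ℂ} (hq : Continuous q) (h : ∀ s t, Complex.exp (q s) = Complex.exp (q t)) (s t : A) :
    q s = q t :=
  Complex.isCoveringMap_exp.const_of_comp hq (fun a b => Subtype.ext (h a b)) s t

/-- **Borsuk–Ulam** for the two-dimensional sphere: an odd map to the plane has a zero on the
sphere. -/
theorem exists_zero_on_sphere_of_odd {f : EuclideanSpace ℝ (Fin 3) → ℂ} (hf : Continuous f)
    (hodd : ∀ x, f (-x) = -f x) : ∃ x, ‖x‖ = 1 ∧ f x = 0 := by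
  by_contra! hne
  let p : ℝ × ℝ → EuclideanSpace ℝ (Fin 3) := fun z =>
    !₂[Real.cos z.1 * Real.cos z.2, Real.sin z.1 * Real.cos z.2, Real.sin z.2]
  have hp : Continuous p := by
    refine (PiLp.continuous_toLp 2 _).comp (continuous_pi fun i => ?_)
    fin_cases i <;> simp <;> fun_prop
  have hnorm : ∀ z, ‖p z‖ = 1 := by
    intro z
    rw [EuclideanSpace.norm_eq, Real.sqrt_eq_one]
    simp only [p, Fin.sum_univ_three, Real.norm_eq_abs, sq_abs, Matrix.cons_val]
    nlinarith [Real.sin_sq_add_cos_sq z.1, Real.sin_sq_add_cos_sq z.2]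
  have hturn : ∀ s t, p (s + 2 * Real.pi, t) = p (s, t) := by
    intro s t; simp [p]
  have hhalf : ∀ s, p (s + Real.pi, 0) = -p (s, 0) := by
    intro s; ext i; fin_cases i <;> simp [p]
  have hpole : ∀ s t, p (s, Real.pi / 2) = p (t, Real.pi / 2) := by
    intro s t; simp [p]
  have hne' : ∀ z, f (p z) ≠ 0 := fun z => hne _ (hnorm z)
  obtain ⟨θ, ⟨-, hθ⟩, -⟩ := Complex.isCoveringMapOn_exp.existsUnique_continuousMap_lifts
    ⟨fun z => f (p z), hf.comp hp⟩ (a₀ := 0) (e₀ := Complex.log (f (p 0)))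
    (Complex.exp_log (hne' 0)) hne'
  have hθ' : ∀ z, Complex.exp (θ z) = f (p z) := congrFun hθ
  have hm := eq_of_continuous_of_exp_eq (q := fun s : ℝ => θ (s + Real.pi, 0) - θ (s, 0))
    (by fun_prop) (fun s t => by
      simp only [Complex.exp_sub, hθ', hhalf, hodd, neg_div, div_self (hne' _)])
  have hk := eq_of_continuous_of_exp_eq (q := fun t : ℝ => θ (0 + 2 * Real.pi, t) - θ (0, t))
    (by fun_prop) (fun s t => by
      simp only [Complex.exp_sub, hθ', hturn, div_self (hne' _)])
  have hpole' := eq_of_continuous_of_exp_eq (q := fun s : ℝ => θ (s, Real.pi / 2))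
    (by fun_prop) (fun s t => by simp only [hθ', hpole s t])
  have h1 := hm 0 Real.pi
  have h2 := hk 0 (Real.pi / 2)
  have h3 := hpole' (0 + 2 * Real.pi) 0
  have h4 : Complex.exp (θ (0 + Real.pi, 0)) = -Complex.exp (θ (0, 0)) := by
    rw [hθ', hθ', hhalf, hodd]
  rw [h3, sub_self, show (0 : ℝ) + 2 * Real.pi = Real.pi + Real.pi by ring] at h2
  have h5 : θ (0 + Real.pi, 0) = θ (0, 0) := by
    have h6 : θ (0 + Real.pi, 0) = θ (Real.pi, 0) := by rw [zero_add]
    linear_combination (1 / 2 : ℂ) * h1 + (1 / 2 : ℂ) * h2 + (1 / 2 : ℂ) * h6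
  rw [h5] at h4
  have := Complex.exp_ne_zero (θ (0, 0))
  exact this (by linear_combination (1 / 2 : ℂ) * h4)

end BorsukUlam

section LocalInjectivity

variable {E F : Type*} [NormedAddCommGroup E] [NormedSpace ℝ E] [FiniteDimensional ℝ E]
  [NormedAddCommGroup F] [NormedSpace ℝ F]

theorem HasStrictFDerivAt.eventually_injective {Ψ : E → F} {A : E →L[ℝ] F} {p : E}
    (h : HasStrictFDerivAt Ψ A p) (hA : ∀ u, A u = 0 → u = 0) :
    ∀ᶠ z : E × E in 𝓝 (p, p), Ψ z.1 = Ψ z.2 → z.1 = z.2 := by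
  obtain ⟨K, hK, hanti⟩ := LinearMap.exists_antilipschitzWith (A : E →ₗ[ℝ] F)
    (LinearMap.ker_eq_bot'.2 hA)
  have hbd := h.isLittleO.def (c := (2 * K : ℝ)⁻¹) (by positivity)
  filter_upwards [hbd] with z hz heq
  rw [heq, sub_self, zero_sub, norm_neg] at hz
  have h1 := hanti.le_mul_dist z.1 z.2
  rw [dist_eq_norm, dist_eq_norm, ← map_sub] at h1
  have hK' : (0 : ℝ) < K := hK
  have h2 : (K : ℝ) * ‖A (z.1 - z.2)‖ ≤ 1 / 2 * ‖z.1 - z.2‖ := by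
    calc (K : ℝ) * ‖A (z.1 - z.2)‖ ≤ K * ((2 * K : ℝ)⁻¹ * ‖z.1 - z.2‖) := by gcongr
      _ = _ := by field_simp
  have h3 : ‖z.1 - z.2‖ ≤ 1 / 2 * ‖z.1 - z.2‖ := h1.trans h2
  exact sub_eq_zero.1 (norm_le_zero_iff.1 (by linarith))

end LocalInjectivity

section Arcs

variable {E : Type*} [NormedAddCommGroup E] [InnerProductSpace ℝ E]

/-- If a set is locally parametrised near `γ t₀` by the linear coordinate along the velocity of
`γ`, then any short arc of a curve in the set is a neighbourhood of `γ t₀` within the set. -/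
theorem image_Ioo_mem_nhdsWithin {Z : Set E} {γ : ℝ → E} {w : E} {t₀ : ℝ}
    (hγ : HasStrictDerivAt γ w t₀) (hw : w ≠ 0) (hZ : ∀ t, γ t ∈ Z)
    (hinj : ∀ᶠ z : E × E in 𝓝 (γ t₀, γ t₀),
      z.1 ∈ Z → z.2 ∈ Z → inner ℝ w z.1 = inner ℝ w z.2 → z.1 = z.2)
    {ε : ℝ} (hε : 0 < ε) : γ '' Ioo (t₀ - ε) (t₀ + ε) ∈ 𝓝[Z] γ t₀ := by
  rw [nhds_prod_eq] at hinj
  obtain ⟨U, hU, hUinj⟩ := eventually_prod_self_iff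
    (r := fun x y => x ∈ Z → y ∈ Z → inner ℝ w x = inner ℝ w y → x = y) |>.1 hinj
  have hφ : HasStrictDerivAt (fun t => inner ℝ w (γ t)) (inner ℝ w w) t₀ :=
    ((innerSL ℝ w).hasStrictFDerivAt).comp_hasStrictDerivAt t₀ hγ
  have hV : Ioo (t₀ - ε) (t₀ + ε) ∩ γ ⁻¹' U ∈ 𝓝 t₀ :=
    inter_mem (Ioo_mem_nhds (by linarith) (by linarith))
      (hγ.hasDerivAt.continuousAt.preimage_mem_nhds hU)
  have himg := image_mem_map (m := fun t => inner ℝ w (γ t)) hV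
  rw [hφ.map_nhds_eq (inner_self_ne_zero.2 hw)] at himg
  have hcont : Continuous fun x : E => (inner ℝ w x : ℝ) := by fun_prop
  filter_upwards [self_mem_nhdsWithin, mem_nhdsWithin_of_mem_nhds hU,
    mem_nhdsWithin_of_mem_nhds (hcont.continuousAt.preimage_mem_nhds himg)] with x hxZ hxU hx
  obtain ⟨t, ⟨ht, htU⟩, hteq⟩ := hx
  exact ⟨t, ht, hUinj _ htU _ hxU (hZ t) hxZ hteq⟩

end Arcs

section CrossProduct

/-- The cross product on Euclidean three-space. -/
def euclideanCross (a b : EuclideanSpace ℝ (Fin 3)) : EuclideanSpace ℝ (Fin 3) :=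
  !₂[a 1 * b 2 - a 2 * b 1, a 2 * b 0 - a 0 * b 2, a 0 * b 1 - a 1 * b 0]

theorem inner_fin_three (a b : EuclideanSpace ℝ (Fin 3)) :
    inner ℝ a b = a 0 * b 0 + a 1 * b 1 + a 2 * b 2 := by
  simp [PiLp.inner_apply, Fin.sum_univ_three, mul_comm]

theorem inner_left_euclideanCross (a b : EuclideanSpace ℝ (Fin 3)) :
    inner ℝ a (euclideanCross a b) = 0 := by
  rw [inner_fin_three]; simp [euclideanCross]; ring

theorem inner_right_euclideanCross (a b : EuclideanSpace ℝ (Fin 3)) :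
    inner ℝ b (euclideanCross a b) = 0 := by
  rw [inner_fin_three]; simp [euclideanCross]; ring

theorem euclideanCross_neg_left (a b : EuclideanSpace ℝ (Fin 3)) :
    euclideanCross (-a) b = -euclideanCross a b := by
  ext i; fin_cases i <;> simp [euclideanCross] <;> ring

theorem euclideanCross_zero_right (a : EuclideanSpace ℝ (Fin 3)) : euclideanCross a 0 = 0 := by
  ext i; fin_cases i <;> simp [euclideanCross]

theorem eq_zero_of_inner_eq_zero_of_inner_euclideanCross_eq_zero {a b u : EuclideanSpace ℝ (Fin 3)}
    (hab : euclideanCross a b ≠ 0) (ha : inner ℝ a u = 0) (hb : inner ℝ b u = 0)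
    (hc : inner ℝ (euclideanCross a b) u = 0) : u = 0 := by
  have key : inner ℝ (euclideanCross a b) (euclideanCross a b) * inner ℝ u u =
      inner ℝ (euclideanCross a b) u ^ 2 +
        (inner ℝ b u ^ 2 * inner ℝ a a + inner ℝ a u ^ 2 * inner ℝ b b -
          2 * inner ℝ a u * inner ℝ b u * inner ℝ a b) := by
    simp only [inner_fin_three]
    simp [euclideanCross]
    ring
  rw [ha, hb, hc] at key
  have h : inner ℝ (euclideanCross a b) (euclideanCross a b) * inner ℝ u u = 0 := by
    rw [key]; ring
  rcases mul_eq_zero.1 h with h | h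
  · exact absurd (inner_self_eq_zero.1 h) hab
  · exact inner_self_eq_zero.1 h

theorem eq_smul_of_euclideanCross_eq_zero {a b : EuclideanSpace ℝ (Fin 3)} (ha : ‖a‖ = 1)
    (h : euclideanCross a b = 0) : b = inner ℝ a b • a := by
  have h1 : a 0 * a 0 + a 1 * a 1 + a 2 * a 2 = 1 := by
    rw [← inner_fin_three, real_inner_self_eq_norm_sq, ha, one_pow]
  have e (i : Fin 3) : euclideanCross a b i = 0 := by rw [h]; rfl
  have e0 := e 0
  have e1 := e 1
  have e2 := e 2
  simp only [euclideanCross, PiLp.toLp_apply, Matrix.cons_val] at e0 e1 e2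
  ext i
  rw [inner_fin_three]
  fin_cases i <;> simp
  · linear_combination (-b 0) * h1 + a 2 * e1 - a 1 * e2
  · linear_combination (-b 1) * h1 + a 0 * e2 - a 2 * e0
  · linear_combination (-b 2) * h1 + a 1 * e0 - a 0 * e1

theorem ContDiff.euclideanCross {F : Type*} [NormedAddCommGroup F] [NormedSpace ℝ F]
    {n : WithTop ℕ∞} {f g : F → EuclideanSpace ℝ (Fin 3)} (hf : ContDiff ℝ n f)
    (hg : ContDiff ℝ n g) : ContDiff ℝ n fun x => euclideanCross (f x) (g x) := by
  have hf' := contDiff_euclidean.1 hf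
  have hg' := contDiff_euclidean.1 hg
  rw [contDiff_euclidean]
  intro i
  fin_cases i
  · exact ((hf' 1).mul (hg' 2)).sub ((hf' 2).mul (hg' 1))
  · exact ((hf' 2).mul (hg' 0)).sub ((hf' 0).mul (hg' 2))
  · exact ((hf' 0).mul (hg' 1)).sub ((hf' 1).mul (hg' 0))

end CrossProduct

section HamiltonianFlow

/-- The Hamiltonian vector field `x ↦ x × ∇G x`, tangent to the spheres and to the level sets
of `G`. -/
noncomputable def hamiltonianField (G : EuclideanSpace ℝ (Fin 3) → ℝ)
    (x : EuclideanSpace ℝ (Fin 3)) : EuclideanSpace ℝ (Fin 3) :=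
  euclideanCross x (gradient G x)

variable {G : EuclideanSpace ℝ (Fin 3) → ℝ}

theorem contDiff_hamiltonianField (hG : ContDiff ℝ 2 G) : ContDiff ℝ 1 (hamiltonianField G) :=
  contDiff_id.euclideanCross
    ((InnerProductSpace.toDual ℝ _).symm.contDiff.comp (hG.fderiv_right (by norm_num)))

theorem hasCompactSupport_hamiltonianField (hG : HasCompactSupport G) :
    HasCompactSupport (hamiltonianField G) := by
  refine (hG.fderiv ℝ).mono fun x hx h => hx ?_
  rw [hamiltonianField, gradient, h, map_zero, euclideanCross_zero_right]

theorem hamiltonianField_neg (hG : ContDiff ℝ 2 G) (hodd : ∀ x, G (-x) = -G x)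
    (x : EuclideanSpace ℝ (Fin 3)) : hamiltonianField G (-x) = -hamiltonianField G x := by
  have hd : Differentiable ℝ G := hG.differentiable (by norm_num)
  have h1 : fderiv ℝ (fun y => G (-y)) x = -fderiv ℝ G (-x) := by
    refine ((hd (-x)).hasFDerivAt.comp x (hasFDerivAt_id x).neg).fderiv.trans ?_
    ext u
    simp
  have h2 : fderiv ℝ (fun y => G (-y)) x = -fderiv ℝ G x := by
    rw [funext hodd]; exact fderiv_neg
  have h3 : gradient G (-x) = gradient G x := by
    rw [gradient, gradient, neg_injective (h1.symm.trans h2)]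
  rw [hamiltonianField, hamiltonianField, h3, euclideanCross_neg_left]

/-- The zero set of `G` on the unit sphere. -/
def sphereZeros (G : EuclideanSpace ℝ (Fin 3) → ℝ) : Set (EuclideanSpace ℝ (Fin 3)) :=
  {x | ‖x‖ = 1 ∧ G x = 0}

theorem isCompact_sphereZeros (hG : Continuous G) : IsCompact (sphereZeros G) := by
  have : sphereZeros G = Metric.sphere 0 1 ∩ G ⁻¹' {0} := by
    ext x; simp [sphereZeros]
  rw [this]
  exact (isCompact_sphere 0 1).inter_right (isClosed_singleton.preimage hG)

theorem integralCurve_mem_sphereZeros (hG : ContDiff ℝ 2 G) {γ : ℝ → EuclideanSpace ℝ (Fin 3)}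
    (hγ : ∀ t, HasDerivAt γ (hamiltonianField G (γ t)) t) (h0 : γ 0 ∈ sphereZeros G) (t : ℝ) :
    γ t ∈ sphereZeros G := by
  have hd : Differentiable ℝ G := hG.differentiable (by norm_num)
  have h1 : ∀ t, HasDerivAt (fun t => ‖γ t‖ ^ 2) 0 t := by
    intro t
    have := (hγ t).norm_sq
    rwa [hamiltonianField, inner_left_euclideanCross, mul_zero] at this
  have h2 : ∀ t, HasDerivAt (fun t => G (γ t)) 0 t := by
    intro t
    have := (hd (γ t)).hasFDerivAt.comp_hasDerivAt t (hγ t)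
    rwa [← inner_gradient_left, hamiltonianField, inner_right_euclideanCross] at this
  have e1 := is_const_of_deriv_eq_zero (fun t => (h1 t).differentiableAt)
    (fun t => (h1 t).deriv) t 0
  have e2 := is_const_of_deriv_eq_zero (fun t => (h2 t).differentiableAt)
    (fun t => (h2 t).deriv) t 0
  simp only [h0.1, h0.2] at e1 e2
  exact ⟨by rw [one_pow] at e1; nlinarith [norm_nonneg (γ t)], e2⟩

theorem eventually_injective_sphereZeros (hG : ContDiff ℝ 2 G) {p : EuclideanSpace ℝ (Fin 3)}
    (hp : hamiltonianField G p ≠ 0) :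
    ∀ᶠ z : EuclideanSpace ℝ (Fin 3) × EuclideanSpace ℝ (Fin 3) in 𝓝 (p, p),
      z.1 ∈ sphereZeros G → z.2 ∈ sphereZeros G →
      inner ℝ (hamiltonianField G p) z.1 = inner ℝ (hamiltonianField G p) z.2 → z.1 = z.2 := by
  have hΨ := ((hasStrictFDerivAt_norm_sq p).prodMk
    ((hG.contDiffAt.hasStrictFDerivAt (by norm_num)).prodMk
      (innerSL ℝ (hamiltonianField G p)).hasStrictFDerivAt))
  have := hΨ.eventually_injective (fun u hu => by
    simp only [ContinuousLinearMap.prod_apply, Prod.mk_eq_zero, smul_apply,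
      innerSL_apply_apply, smul_eq_zero] at hu
    obtain ⟨h1, h2, h3⟩ := hu
    refine eq_zero_of_inner_eq_zero_of_inner_euclideanCross_eq_zero hp ?_ ?_ h3
    · simpa using h1
    · rwa [inner_gradient_left])
  filter_upwards [this] with z hz h1 h2 h3
  refine hz ?_
  simp [h1.1, h1.2, h2.1, h2.2, h3]

theorem image_Ioo_mem_nhdsWithin_sphereZeros (hG : ContDiff ℝ 2 G)
    (hreg : ∀ x ∈ sphereZeros G, hamiltonianField G x ≠ 0) {γ : ℝ → EuclideanSpace ℝ (Fin 3)}
    (hγ : ∀ t, HasDerivAt γ (hamiltonianField G (γ t)) t) (h0 : γ 0 ∈ sphereZeros G) (t : ℝ) :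
    γ '' Ioo (t - 1) (t + 1) ∈ 𝓝[sphereZeros G] γ t := by
  have hmem := integralCurve_mem_sphereZeros hG hγ h0
  have hcont : Continuous γ := continuous_iff_continuousAt.2 fun t => (hγ t).continuousAt
  have hstrict : HasStrictDerivAt γ (hamiltonianField G (γ t)) t :=
    hasStrictDerivAt_of_hasDerivAt_of_continuousAt (Eventually.of_forall hγ)
      ((contDiff_hamiltonianField hG).continuous.comp hcont).continuousAt
  exact image_Ioo_mem_nhdsWithin hstrict (hreg _ (hmem t)) hmem
    (eventually_injective_sphereZeros hG (hreg _ (hmem t))) one_pos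

theorem exists_symmetric_circle_of_contDiff (hG : ContDiff ℝ 2 G) (hsupp : HasCompactSupport G)
    (hodd : ∀ x, G (-x) = -G x) (hreg : ∀ x ∈ sphereZeros G, hamiltonianField G x ≠ 0) :
    ∃ f : Circle → EuclideanSpace ℝ (Fin 3), Continuous f ∧ Function.Injective f ∧
      range f ⊆ sphereZeros G ∧ -range f = range f := by
  set v := hamiltonianField G with hv
  have hv1 : ContDiff ℝ 1 v := contDiff_hamiltonianField hG
  have hvc : HasCompactSupport v := hasCompactSupport_hamiltonianField hsupp
  obtain ⟨K, hK⟩ := hv1.lipschitzWith_of_hasCompactSupport hvc one_ne_zero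
  obtain ⟨L, hL⟩ := hvc.exists_bound_of_continuous hv1.continuous
  have hL' : ∀ x, ‖v x‖ ≤ L.toNNReal := fun x => (hL x).trans (Real.le_coe_toNNReal L)
  choose γ h0 hγ using hK.exists_global_integralCurve hL'
  have hcont : ∀ x, Continuous (γ x) := fun x =>
    continuous_iff_continuousAt.2 fun t => (hγ x t).continuousAt
  have hshift : ∀ x s, γ (γ x s) = fun t => γ x (t + s) := fun x s =>
    hK.integralCurve_unique (hγ _) (fun t => (hγ x (t + s)).comp_add_const t s)
      (t₀ := 0) (by rw [h0, zero_add])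
  have hneg : ∀ x, γ (-x) = fun t => -γ x t := fun x =>
    hK.integralCurve_unique (hγ _) (fun t => by
      rw [hv, hamiltonianField_neg hG hodd]; exact (hγ x t).neg) (t₀ := 0) (by rw [h0, h0])
  have hrange : ∀ {x y}, y ∈ range (γ x) → range (γ y) = range (γ x) := by
    rintro x _ ⟨s, rfl⟩
    rw [hshift]
    exact (Equiv.addRight s).surjective.range_comp (γ x)
  have hrange_neg : ∀ x, range (γ (-x)) = -range (γ x) := by
    intro x
    rw [hneg, ← Set.image_neg_eq_neg, ← range_comp]; rfl
  have hself : ∀ x, x ∈ range (γ x) := fun x => ⟨0, h0 x⟩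
  have hmem : ∀ {x}, x ∈ sphereZeros G → ∀ t, γ x t ∈ sphereZeros G := fun {x} hx =>
    integralCurve_mem_sphereZeros hG (hγ x) ((h0 x).symm ▸ hx)
  have hnhds : ∀ {x}, x ∈ sphereZeros G → ∀ t,
      γ x '' Ioo (t - 1) (t + 1) ∈ 𝓝[sphereZeros G] γ x t := fun {x} hx =>
    image_Ioo_mem_nhdsWithin_sphereZeros hG hreg (hγ x) ((h0 x).symm ▸ hx)
  have hopen : ∀ {x}, x ∈ sphereZeros G → range (γ x) ∈ 𝓝[sphereZeros G] x := fun {x} hx =>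
    mem_of_superset (by simpa [h0] using hnhds hx 0) (image_subset_range _ _)
  have hZ := isCompact_sphereZeros hG.continuous
  have hnegZ : ∀ {x}, x ∈ sphereZeros G → -x ∈ sphereZeros G := fun {x} hx =>
    ⟨by rw [norm_neg, hx.1], by rw [hodd, hx.2, neg_zero]⟩
  obtain ⟨x, hx, hsym⟩ : ∃ x ∈ sphereZeros G, range (γ (-x)) = range (γ x) := by
    by_contra! hne
    classical
    let r : EuclideanSpace ℝ (Fin 3) → Prop := fun x =>
      WellOrderingRel (range (γ x)) (range (γ (-x)))
    let φ : EuclideanSpace ℝ (Fin 3) → ℝ := fun x => if r x then 1 else -1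
    have hφ : ContinuousOn φ (sphereZeros G) := by
      intro x hx
      refine (continuousWithinAt_const (b := φ x)).congr_of_eventuallyEq ?_ rfl
      filter_upwards [hopen hx] with y hy
      simp only [φ, r, hrange_neg, hrange hy]
    obtain ⟨ψ, hψ⟩ := ContinuousMap.exists_restrict_eq hZ.isClosed ⟨_, hφ.domRestrict⟩
    have hψφ : ∀ x ∈ sphereZeros G, ψ x = φ x := fun x hx => DFunLike.congr_fun hψ ⟨x, hx⟩
    have hφodd : ∀ x ∈ sphereZeros G, φ (-x) = -φ x := by
      intro x hx
      have hnot : r (-x) ↔ ¬ r x := by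
        simp only [r, neg_neg]
        constructor
        · exact fun h h' => asymm_of WellOrderingRel h h'
        · intro h
          rcases trichotomous_of WellOrderingRel (range (γ x)) (range (γ (-x))) with h' | h' | h'
          · exact absurd h' h
          · exact absurd h'.symm (hne x hx)
          · exact h'
      simp only [φ, hnot]
      split_ifs <;> simp_all
    obtain ⟨x, hx1, hx2⟩ := exists_zero_on_sphere_of_odd
      (f := fun x => (G x : ℂ) + ((ψ x - ψ (-x) : ℝ) : ℂ) * Complex.I)
      (by have := hG.continuous; fun_prop) (fun x => by rw [hodd, neg_neg]; push_cast; ring)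
    have hG0 : G x = 0 := by simpa using congrArg Complex.re hx2
    have hψ0 : ψ x - ψ (-x) = 0 := by simpa using congrArg Complex.im hx2
    have hx : x ∈ sphereZeros G := ⟨hx1, hG0⟩
    rw [hψφ x hx, hψφ _ (hnegZ hx), hφodd x hx] at hψ0
    simp only [φ] at hψ0
    split_ifs at hψ0 <;> norm_num at hψ0
  have hsub : range (γ x) ⊆ sphereZeros G := range_subset_iff.2 (hmem hx)
  have hclosed : IsClosed (range (γ x)) := by
    refine isClosed_of_closure_subset fun y hy => ?_
    have hyZ : y ∈ sphereZeros G := hZ.isClosed.closure_subset_iff.2 hsub hy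
    have : range (γ y) ∈ 𝓝[range (γ x)] y := nhdsWithin_mono _ hsub (hopen hyZ)
    have hne : (𝓝[range (γ x)] y).NeBot := mem_closure_iff_nhdsWithin_neBot.1 hy
    obtain ⟨z, hzy, hzx⟩ := Filter.nonempty_of_mem (inter_mem this self_mem_nhdsWithin)
    rw [← hrange hzx, hrange hzy]
    exact hself y
  have hper : ∀ s t, γ x s = γ x t → Function.Periodic (γ x) (s - t) := by
    intro s t hst u
    have := congrFun ((hshift x s).symm.trans ((congrArg γ hst).trans (hshift x t))) (u - t)
    simp only [sub_add_cancel] at this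
    rw [← this]; congr 1; ring
  have hconst : ∃ s t, γ x s ≠ γ x t := by
    by_contra! h
    have hd : HasDerivAt (γ x) 0 0 := by
      rw [show γ x = fun _ => γ x 0 from funext fun s => h s 0]
      exact hasDerivAt_const _ _
    exact hreg _ (hmem hx 0) ((hγ x 0).unique hd)
  rcases injective_or_exists_circle_param (hcont x) hper hconst with hinj | ⟨f, hf, hfi, hfr⟩
  · exact absurd hinj (not_injective_of_isCompact_range (hZ.of_isClosed_subset hclosed hsub)
      fun t => nhdsWithin_mono _ hsub (hnhds hx t))
  · exact ⟨f, hf, hfi, hfr ▸ hsub, by rw [hfr, ← hrange_neg, hsym]⟩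

end HamiltonianFlow

section SphereExtension

open scoped Manifold ContDiff

/-- The homogeneous extension of `g` off the unit sphere, cut off near the origin and infinity. -/
noncomputable def cutoffExtension
    (g : Metric.sphere (0 : EuclideanSpace ℝ (Fin 3)) 1 → ℝ) (x : EuclideanSpace ℝ (Fin 3)) : ℝ :=
  open Classical in
  if hx : x = 0 then 0 else
    (⟨1 / 4, 1 / 2, by norm_num, by norm_num⟩ : ContDiffBump (1 : ℝ)) (‖x‖ ^ 2) *
      g ⟨‖x‖⁻¹ • x, by simp [norm_smul, hx]⟩

variable {g : Metric.sphere (0 : EuclideanSpace ℝ (Fin 3)) 1 → ℝ}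

theorem cutoffExtension_coe (x : Metric.sphere (0 : EuclideanSpace ℝ (Fin 3)) 1) :
    cutoffExtension g x = g x := by
  have hx : ‖(x : EuclideanSpace ℝ (Fin 3))‖ = 1 := norm_eq_of_mem_sphere x
  rw [cutoffExtension, dif_neg (ne_zero_of_mem_unit_sphere x), ContDiffBump.one_of_mem_closedBall,
    one_mul]
  · congr 1
    ext1
    simp [hx]
  · simp [hx]

theorem cutoffExtension_neg (hodd : ∀ x, g (-x) = -g x) (x : EuclideanSpace ℝ (Fin 3)) :
    cutoffExtension g (-x) = -cutoffExtension g x := by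
  by_cases hx : x = 0
  · simp [cutoffExtension, hx]
  · rw [cutoffExtension, cutoffExtension, dif_neg hx, dif_neg (neg_ne_zero.2 hx), ← mul_neg,
      ← hodd]
    congr 2
    · rw [norm_neg]
    · ext1
      simp

theorem hasCompactSupport_cutoffExtension : HasCompactSupport (cutoffExtension g) := by
  refine HasCompactSupport.intro (isCompact_closedBall 0 2) fun x hx => ?_
  have hx' : 2 < ‖x‖ := by simpa using hx
  rw [cutoffExtension]
  split_ifs with h
  · rfl
  · rw [ContDiffBump.zero_of_le_dist, zero_mul]
    rw [Real.dist_eq, le_abs]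
    left
    show (1 / 2 : ℝ) ≤ _
    nlinarith

theorem contDiff_cutoffExtension (hg : ContMDiff (𝓡 2) 𝓘(ℝ, ℝ) ∞ g) :
    ContDiff ℝ ∞ (cutoffExtension g) := by
  have : Fact (Module.finrank ℝ (EuclideanSpace ℝ (Fin 3)) = 2 + 1) := ⟨by simp⟩
  rw [contDiff_iff_contDiffAt]
  intro x
  by_cases hx : x = 0
  · refine (contDiffAt_const (c := (0 : ℝ))).congr_of_eventuallyEq ?_
    filter_upwards [Metric.ball_mem_nhds x (show (0 : ℝ) < 1 / 2 by norm_num)] with y hy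
    have hy' : ‖y‖ < 1 / 2 := by simpa [hx] using hy
    rw [cutoffExtension]
    split_ifs with h
    · rfl
    · rw [ContDiffBump.zero_of_le_dist, zero_mul]
      rw [Real.dist_eq, le_abs]
      right
      show (1 / 2 : ℝ) ≤ _
      nlinarith [norm_nonneg y]
  · let U : TopologicalSpace.Opens (EuclideanSpace ℝ (Fin 3)) := ⟨{0}ᶜ, isOpen_compl_singleton⟩
    have hU (y : U) : (y : EuclideanSpace ℝ (Fin 3)) ≠ 0 := y.2
    have hcoe : ContMDiff 𝓘(ℝ, EuclideanSpace ℝ (Fin 3)) 𝓘(ℝ, EuclideanSpace ℝ (Fin 3)) ∞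
        ((↑) : U → EuclideanSpace ℝ (Fin 3)) := contMDiff_subtype_val
    have hproj : ContMDiff 𝓘(ℝ, EuclideanSpace ℝ (Fin 3)) 𝓘(ℝ, EuclideanSpace ℝ (Fin 3)) ∞
        (fun y : U => ‖(y : EuclideanSpace ℝ (Fin 3))‖⁻¹ • (y : EuclideanSpace ℝ (Fin 3))) := by
      intro y
      exact (((contDiffAt_norm ℝ (hU y)).inv (norm_ne_zero_iff.2 (hU y))).smul
        contDiffAt_id).contMDiffAt.comp y (hcoe y)
    have hsphere := hproj.codRestrict_sphere (n := 2) fun y => by simp [norm_smul, hU y]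
    let b : ContDiffBump (1 : ℝ) := ⟨1 / 4, 1 / 2, by norm_num, by norm_num⟩
    have hb : ContDiff ℝ ∞ fun y : EuclideanSpace ℝ (Fin 3) => b (‖y‖ ^ 2) :=
      b.contDiff.comp (contDiff_norm_sq ℝ)
    have hmul : ContMDiff 𝓘(ℝ, EuclideanSpace ℝ (Fin 3)) 𝓘(ℝ, ℝ) ∞
        (fun y : U => cutoffExtension g y) := by
      refine ((hb.contMDiff.comp hcoe).mul (hg.comp hsphere)).congr fun y => ?_
      rw [cutoffExtension, dif_neg (hU y)]
      rfl
    exact (contMDiffAt_subtype_iff.1 (hmul ⟨x, hx⟩)).contDiffAt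

theorem hamiltonianField_cutoffExtension_ne_zero (hg : ContMDiff (𝓡 2) 𝓘(ℝ, ℝ) ∞ g)
    (x : Metric.sphere (0 : EuclideanSpace ℝ (Fin 3)) 1)
    (hx : mfderiv (𝓡 2) 𝓘(ℝ, ℝ) g x ≠ 0) : hamiltonianField (cutoffExtension g) x ≠ 0 := by
  have : Fact (Module.finrank ℝ (EuclideanSpace ℝ (Fin 3)) = 2 + 1) := ⟨by simp⟩
  intro h
  have hgrad := eq_smul_of_euclideanCross_eq_zero (norm_eq_of_mem_sphere x) h
  have hd : MDifferentiableAt 𝓘(ℝ, EuclideanSpace ℝ (Fin 3)) 𝓘(ℝ, ℝ) (cutoffExtension g) x :=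
    ((contDiff_cutoffExtension hg).differentiable (by simp) x).mdifferentiableAt
  have hcoe : MDifferentiableAt (𝓡 2) 𝓘(ℝ, EuclideanSpace ℝ (Fin 3))
      ((↑) : Metric.sphere (0 : EuclideanSpace ℝ (Fin 3)) 1 → EuclideanSpace ℝ (Fin 3)) x :=
    (contMDiff_coe_sphere x).mdifferentiableAt one_ne_zero
  have hcomp : cutoffExtension g ∘ (↑) = g := funext cutoffExtension_coe
  refine hx ?_
  rw [← hcomp, mfderiv_comp x hd hcoe]
  ext u
  have hu : inner ℝ (x : EuclideanSpace ℝ (Fin 3)) (mvfderiv (𝓡 2)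
      ((↑) : Metric.sphere (0 : EuclideanSpace ℝ (Fin 3)) 1 → EuclideanSpace ℝ (Fin 3)) x u) = 0 :=
    Submodule.mem_orthogonal_singleton_iff_inner_right.1
      (range_mvfderiv_subtypeVal (n := 2) x ▸ LinearMap.mem_range_self _ u)
  rw [mfderiv_eq_fderiv]
  change fderiv ℝ (cutoffExtension g) x (mvfderiv (𝓡 2)
      ((↑) : Metric.sphere (0 : EuclideanSpace ℝ (Fin 3)) 1 → EuclideanSpace ℝ (Fin 3)) x u) = 0
  rw [← inner_gradient_left, hgrad, real_inner_smul_left, hu, mul_zero]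

end SphereExtension

end

/-- If the combinatorial theorem holds for every generalized Tucker labelling of every
finite symmetric triangulation of `S²`, then every smooth odd `g : S² → ℝ` with `0` as a
regular value has an antipodally invariant simple closed curve in its zero set. -/
theorem invariant_circle_of_combinatorial
    (H : ∀ (T : SymmetricSphereTriangulation) (ℓ L : EuclideanSpace ℝ (Fin 3) → ℝ),
      IsGenTuckerLabelling T ℓ → IsSimplicialExtension T ℓ L →
      ∃ P : Set (EuclideanSpace ℝ (Fin 3)),
        P ⊆ T.K.space ∧ IsPolygonalSimpleClosedPath P ∧
        (∀ x ∈ P, L x = 0) ∧ ((fun x => -x) '' P = P))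
    (g : Metric.sphere (0 : EuclideanSpace ℝ (Fin 3)) 1 → ℝ)
    (hsmooth : ContMDiff (𝓡 2) 𝓘(ℝ, ℝ) (⊤ : ℕ∞) g)
    (hodd : ∀ x, g (-x) = -g x)
    (hreg : ∀ x, g x = 0 → mfderiv (𝓡 2) 𝓘(ℝ, ℝ) g x ≠ 0) :
    ∃ C : Set (Metric.sphere (0 : EuclideanSpace ℝ (Fin 3)) 1),
      (∃ f : Circle → Metric.sphere (0 : EuclideanSpace ℝ (Fin 3)) 1,
        Continuous f ∧ Function.Injective f ∧ Set.range f = C) ∧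
      C ⊆ g ⁻¹' {0} ∧ (-C = C) := by
  have hmem : ∀ x ∈ sphereZeros (cutoffExtension g), ∃ y, g y = 0 ∧ y.1 = x := fun x hx =>
    ⟨⟨x, by simpa using hx.1⟩, by rw [← cutoffExtension_coe (g := g)]; exact hx.2, rfl⟩
  obtain ⟨f, hf, hfi, hfZ, hfneg⟩ := exists_symmetric_circle_of_contDiff
    ((contDiff_cutoffExtension hsmooth).of_le (by norm_cast))
    hasCompactSupport_cutoffExtension (cutoffExtension_neg hodd) (by
      intro x hx
      obtain ⟨y, hy, rfl⟩ := hmem x hx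
      exact hamiltonianField_cutoffExtension_ne_zero hsmooth y (hreg y hy))
  choose F hF0 hF using fun z => hmem (f z) (hfZ ⟨z, rfl⟩)
  refine ⟨Set.range F, ⟨F, ?_, ?_, rfl⟩, ?_, ?_⟩
  · exact continuous_induced_rng.2 (hf.congr fun z => (hF z).symm)
  · exact fun z w hzw => hfi (by rw [← hF, ← hF, hzw])
  · rintro _ ⟨z, rfl⟩
    exact hF0 z
  · ext y
    have hy : ∀ y, y ∈ Set.range F ↔ y.1 ∈ Set.range f := fun y =>
      exists_congr fun z => by rw [← hF, Subtype.ext_iff]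
    rw [Set.mem_neg, hy, hy, ← hfneg, Set.mem_neg]
    simp [hfneg]
end
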